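/- arXiv:1409.6489 — 9 statements merged into one kernel-verified Lean document; each statement's English description precedes it below -/
import Mathlib

section
/- Let a two-player game have preferences ≺_a and ≺_b that are transitive and pseudo-transitive. Let s_0 →_b s_1 →_a s_2 →_b s_3 →_a s_4 →_b s_5 be an improvement path whose profiles s_0, …, s_5 are pairwise distinct. Assume that (i) there is no improvement path from s_0 to s_5 of length strictly less than 5 all of whose profiles lie in the sheath of the given path and in which both players perform at least one step, and (ii) no rectangle all four of whose profiles lie in the sheath is a forbidden pattern. Then v(s_3) ≺_a v(s_4) and v(s_4) ⪯_a v(s_1). -/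
section GamePrelims

variable {Sa Sb O : Type*}

/-- Preference of player `p` (`true` = player a, `false` = player b). -/
def PrefOf (pa pb : O → O → Prop) (p : Bool) : O → O → Prop := cond p pa pb

/-- `o ⪯_p o'` means `¬ (o' ≺_p o)`. -/
def Ple (pa pb : O → O → Prop) (p : Bool) (o o' : O) : Prop := ¬ PrefOf pa pb p o' o

/-- `o ∼_p o'`. -/
def Psim (pa pb : O → O → Prop) (p : Bool) (o o' : O) : Prop :=
  Ple pa pb p o o' ∧ Ple pa pb p o' o

/-- Player `p` can convert `s` to `s'` (the other player's component is unchanged). -/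
def Conv (p : Bool) (s s' : Sa × Sb) : Prop := cond p (s.2 = s'.2) (s.1 = s'.1)

/-- Improvement step of player `p`. -/
def Impr (v : Sa × Sb → O) (pa pb : O → O → Prop) (p : Bool) (s s' : Sa × Sb) : Prop :=
  Conv p s s' ∧ PrefOf pa pb p (v s) (v s')

/-- Collective improvement. -/
def Step (v : Sa × Sb → O) (pa pb : O → O → Prop) (s s' : Sa × Sb) : Prop :=
  ∃ p, Impr v pa pb p s s'

/-- Nash equilibrium. -/
def IsNE (v : Sa × Sb → O) (pa pb : O → O → Prop) (s : Sa × Sb) : Prop :=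
  ∀ p s', ¬ Impr v pa pb p s s'

/-- Maximising improvement step of player `p`. -/
def MaxImpr (v : Sa × Sb → O) (pa pb : O → O → Prop) (p : Bool) (s s' : Sa × Sb) : Prop :=
  Impr v pa pb p s s' ∧
    cond p (∀ t : Sa, ¬ pa (v s') (v (t, s.2))) (∀ t : Sb, ¬ pb (v s') (v (s.1, t)))

/-- Rectangle of profiles `w x y z` anchored at player `p`:
`w` and `x` differ exactly in `p`'s component, `x` and `y` in the other player's component,
`y` and `z` in `p`'s component, and `z` and `w` in the other player's component. -/
def Rect (p : Bool) (w x y z : Sa × Sb) : Prop :=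
  cond p
    (w.2 = x.2 ∧ x.1 = y.1 ∧ y.2 = z.2 ∧ z.1 = w.1 ∧ w.1 ≠ x.1 ∧ x.2 ≠ y.2)
    (w.1 = x.1 ∧ x.2 = y.2 ∧ y.1 = z.1 ∧ z.2 = w.2 ∧ w.2 ≠ x.2 ∧ x.1 ≠ y.1)

/-- Elementary cycle. -/
def IsEC (v : Sa × Sb → O) (pa pb : O → O → Prop) (p : Bool) (w x y z : Sa × Sb) : Prop :=
  Rect p w x y z ∧ Impr v pa pb p w x ∧ Impr v pa pb (!p) x y ∧
    Impr v pa pb p y z ∧ Impr v pa pb (!p) z w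

/-- Pareto-useful bypass. -/
def IsPUB (v : Sa × Sb → O) (pa pb : O → O → Prop) (p : Bool) (w x y z : Sa × Sb) : Prop :=
  Rect p w x y z ∧ Impr v pa pb p w x ∧ Impr v pa pb (!p) x y ∧ Impr v pa pb p y z ∧
    Ple pa pb (!p) (v w) (v z) ∧ PrefOf pa pb p (v w) (v z)

/-- Pareto-useless confluence. -/
def IsPUC (v : Sa × Sb → O) (pa pb : O → O → Prop) (p : Bool) (w x y z : Sa × Sb) : Prop :=
  Rect p w x y z ∧ Impr v pa pb p w x ∧ Impr v pa pb (!p) x y ∧ Impr v pa pb (!p) w z ∧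
    Impr v pa pb p z y ∧ PrefOf pa pb (!p) (v y) (v w)

/-- Strict weak order. -/
def IsSWO (r : O → O → Prop) : Prop :=
  Irreflexive r ∧ Transitive r ∧ Transitive (fun x y => ¬ r x y ∧ ¬ r y x)

/-- Pseudo-transitivity. -/
def PseudoTransitive (r : O → O → Prop) : Prop :=
  (∀ x y z, r x y → ¬ r z y → r x z) ∧ (∀ x y z, ¬ r y x → r y z → r x z)

end GamePrelims

/-- The order-theoretic core of `statement1`: `o₀, …, o₅` are the outcomes along the path, `u` and
`t` those at the corners completing the rectangles on `s1, s2, s3` and on `s2, s3, s4`. The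
hypotheses say that the relevant shortcuts and forbidden patterns are absent. -/
theorem not_pref_of_no_shortcut {O : Type*} {pa pb : O → O → Prop}
    (hta : Transitive pa) (htb : Transitive pb)
    (hpta : PseudoTransitive pa) (hptb : PseudoTransitive pb)
    {o₀ o₁ o₂ o₃ o₄ o₅ u t : O}
    (h01 : pb o₀ o₁) (h12 : pa o₁ o₂) (h23 : pb o₂ o₃) (h34 : pa o₃ o₄) (h45 : pb o₄ o₅)
    (path_t : ¬ (pa o₁ t ∧ pb t o₅)) (path_u : ¬ (pb o₀ u ∧ pa u o₄))
    (ec_u : ¬ (pa o₃ u ∧ pb u o₁)) (ec_t : ¬ (pb o₄ t ∧ pa t o₂))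
    (pub_u : ¬ (pa o₃ u ∧ ¬ pb u o₁ ∧ pa o₁ u)) (pub_t : ¬ (pa t o₂ ∧ ¬ pb o₄ t ∧ pa t o₄))
    (pub_t' : ¬ (pb o₄ t ∧ ¬ pa t o₂ ∧ pb o₂ t)) (pub_u' : ¬ (pb u o₁ ∧ ¬ pa o₃ u ∧ pb u o₃))
    (puc : ¬ (pa u o₄ ∧ pb o₄ t ∧ pb u o₁ ∧ pa o₁ t ∧ pb t u)) :
    ¬ pa o₁ o₄ := by
  intro h14
  obtain ⟨hpta₁, hpta₂⟩ := hpta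
  obtain ⟨hptb₁, hptb₂⟩ := hptb
  have ta : ∀ x y z, pa x y → pa y z → pa x z := fun _ _ _ h h' => hta h h'
  have tb : ∀ x y z, pb x y → pb y z → pb x z := fun _ _ _ h h' => htb h h'
  clear hta htb
  grind

theorem statement1 {Sa Sb O : Type*} (v : Sa × Sb → O) (pa pb : O → O → Prop)
    (hta : Transitive pa) (htb : Transitive pb)
    (hpta : PseudoTransitive pa) (hptb : PseudoTransitive pb)
    (s0 s1 s2 s3 s4 s5 : Sa × Sb)
    (h01 : Impr v pa pb false s0 s1) (h12 : Impr v pa pb true s1 s2)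
    (h23 : Impr v pa pb false s2 s3) (h34 : Impr v pa pb true s3 s4)
    (h45 : Impr v pa pb false s4 s5)
    (hdist : List.Pairwise (· ≠ ·) [s0, s1, s2, s3, s4, s5])
    (Sh : Set (Sa × Sb))
    (hSh : Sh = {s0, s1, s2, s3, s4, s5,
      (s2.1, s0.2), (s1.1, s3.2), (s4.1, s2.2), (s3.1, s5.2)})
    (hmin : ¬ ∃ (n : ℕ) (f : ℕ → Sa × Sb) (pl : ℕ → Bool),
      n < 5 ∧ f 0 = s0 ∧ f n = s5 ∧
      (∀ k < n, Impr v pa pb (pl k) (f k) (f (k + 1))) ∧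
      (∀ k ≤ n, f k ∈ Sh) ∧
      (∃ k < n, pl k = true) ∧ (∃ k < n, pl k = false))
    (hforb : ∀ (p : Bool) (w x y z : Sa × Sb), w ∈ Sh → x ∈ Sh → y ∈ Sh → z ∈ Sh →
      ¬ (IsEC v pa pb p w x y z ∨ IsPUB v pa pb p w x y z ∨ IsPUC v pa pb p w x y z)) :
    pa (v s3) (v s4) ∧ Ple pa pb true (v s4) (v s1) := by
  obtain ⟨a0, b0⟩ := s0
  obtain ⟨a1, b1⟩ := s1
  obtain ⟨a2, b2⟩ := s2
  obtain ⟨a3, b3⟩ := s3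
  obtain ⟨a4, b4⟩ := s4
  obtain ⟨a5, b5⟩ := s5
  simp only [Impr, Conv, PrefOf, cond_true, cond_false] at h01 h12 h23 h34 h45
  obtain ⟨rfl, h01⟩ := h01
  obtain ⟨rfl, h12⟩ := h12
  obtain ⟨rfl, h23⟩ := h23
  obtain ⟨rfl, h34⟩ := h34
  obtain ⟨rfl, h45⟩ := h45
  refine ⟨h34, ?_⟩
  simp only [Ple, PrefOf, cond_true]
  simp only [List.pairwise_cons, List.mem_cons, ne_eq] at hdist
  have ha01 : a0 ≠ a2 := by grind
  have ha12 : a2 ≠ a4 := by grind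
  have hb12 : b1 ≠ b3 := by grind
  have m0 : (a0, b0) ∈ Sh := by simp [hSh]
  have m1 : (a0, b1) ∈ Sh := by simp [hSh]
  have m2 : (a2, b1) ∈ Sh := by simp [hSh]
  have m3 : (a2, b3) ∈ Sh := by simp [hSh]
  have m4 : (a4, b3) ∈ Sh := by simp [hSh]
  have m5 : (a4, b5) ∈ Sh := by simp [hSh]
  have mt : (a4, b1) ∈ Sh := by simp [hSh]
  have mu : (a0, b3) ∈ Sh := by simp [hSh]
  have path (x y : Sa × Sb) (hx : x ∈ Sh) (hy : y ∈ Sh) (p : Bool)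
      (h0 : Impr v pa pb false (a0, b0) x) (h1 : Impr v pa pb p x y)
      (h2 : Impr v pa pb (!p) y (a4, b5)) : False := by
    refine hmin ⟨3, fun | 0 => (a0, b0) | 1 => x | 2 => y | _ => (a4, b5),
      fun | 1 => p | 2 => !p | _ => false, by norm_num, rfl, rfl, ?_, ?_, ?_, 0, by norm_num, rfl⟩
    · intro k hk
      interval_cases k <;> assumption
    · intro k hk
      interval_cases k <;> assumption
    · cases p
      · exact ⟨2, by norm_num, rfl⟩
      · exact ⟨1, by norm_num, rfl⟩
  by_cases ha02 : a0 = a4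
  · subst ha02
    have := hforb true _ _ _ _ m1 m2 m3 m4
    simp only [IsEC, IsPUB, Rect, Impr, Conv, Ple, PrefOf, cond_true, cond_false,
      Bool.not_true] at this
    tauto
  have ec_u := hforb true _ _ _ _ m1 m2 m3 mu
  have ec_t := hforb false _ _ _ _ m2 m3 m4 mt
  have pub_t := hforb true _ _ _ _ mt m2 m3 m4
  have pub_u := hforb false _ _ _ _ mu m1 m2 m3
  have puc := hforb true _ _ _ _ mu m4 mt m1
  have path_t := path _ _ m1 mt true
  have path_u := path _ _ mu m4 true
  simp only [IsEC, IsPUB, IsPUC, Rect, Impr, Conv, Ple, PrefOf, cond_true, cond_false,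
    Bool.not_true, Bool.not_false] at ec_u ec_t pub_t pub_u puc path_t path_u
  refine not_pref_of_no_shortcut (u := v (a0, b3)) (t := v (a4, b1))
    hta htb hpta hptb h01 h12 h23 h34 h45 ?_ ?_ ?_ ?_ ?_ ?_ ?_ ?_ ?_ <;> grind
end

section
/- Let a finite two-player game have transitive and pseudo-transitive preferences ≺_a and ≺_b and contain no forbidden pattern. If there is an infinite improvement sequence s_0 → s_1 → s_2 → … in which some player p performs infinitely many of the steps, then the preference ≺_p has a cycle: there exist outcomes o_1 ≺_p o_2 ≺_p … ≺_p o_k ≺_p o_1. -/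
/-- The forbidden patterns are absent from the matrix `w`, whose row player has preference `P` and
whose column player has preference `Q` (`puc` only concerns confluences useless for `Q`). -/
structure PatternFree {A B O : Type*} (P Q : O → O → Prop) (w : A → B → O) : Prop where
  ec : ∀ i i' j j', i ≠ i' → j ≠ j' → P (w i j) (w i' j) → Q (w i' j) (w i' j') →
    P (w i' j') (w i j') → ¬ Q (w i j') (w i j)
  pub_row : ∀ i i' j j', i ≠ i' → j ≠ j' → P (w i j) (w i' j) → Q (w i' j) (w i' j') →
    P (w i' j') (w i j') → ¬ Q (w i j') (w i j) → ¬ P (w i j) (w i j')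
  pub_col : ∀ i i' j j', i ≠ i' → j ≠ j' → Q (w i j) (w i j') → P (w i j') (w i' j') →
    Q (w i' j') (w i' j) → ¬ P (w i' j) (w i j) → ¬ Q (w i j) (w i' j)
  puc : ∀ i i' j j', i ≠ i' → j ≠ j' → P (w i j) (w i' j) → Q (w i' j) (w i' j') →
    Q (w i j) (w i j') → P (w i j') (w i' j') → ¬ Q (w i' j') (w i j)

/-- An improvement of the row player followed by an optional improvement of the column player. -/
def RowColStep {A B O : Type*} (P Q : O → O → Prop) (w : A → B → O) (x y : A × B) : Prop :=
  P (w x.1 x.2) (w y.1 x.2) ∧ (x.2 = y.2 ∨ Q (w y.1 x.2) (w y.1 y.2))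

/-- `y` can be reached from `x` by exactly `n` steps of the relation `R`. -/
def ReachIn {X : Type*} (R : X → X → Prop) : ℕ → X → X → Prop
  | 0, x, y => x = y
  | n + 1, x, y => ∃ z, R x z ∧ ReachIn R n z y

section ReachIn

variable {X : Type*} {R : X → X → Prop}

theorem ReachIn.tail {n : ℕ} {x y z : X} (h : ReachIn R n x y) (hyz : R y z) :
    ReachIn R (n + 1) x z := by
  induction n generalizing x with
  | zero => cases h; exact ⟨z, hyz, rfl⟩
  | succ n ih => obtain ⟨u, hu, h⟩ := h; exact ⟨u, hu, ih h⟩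

theorem ReachIn.trans {m n : ℕ} {x y z : X} (h : ReachIn R m x y) (h' : ReachIn R n y z) :
    ReachIn R (m + n) x z := by
  induction m generalizing x with
  | zero => cases h; simpa using h'
  | succ m ih =>
    obtain ⟨u, hu, h⟩ := h
    rw [Nat.succ_add]
    exact ⟨u, hu, ih h⟩

theorem ReachIn.exists_last {n : ℕ} {x y : X} (h : ReachIn R (n + 1) x y) :
    ∃ z, ReachIn R n x z ∧ R z y := by
  induction n generalizing x with
  | zero => obtain ⟨u, hu, rfl⟩ := h; exact ⟨x, rfl, hu⟩
  | succ n ih =>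
    obtain ⟨u, hu, h⟩ := h
    obtain ⟨z, hz, hzy⟩ := ih h
    exact ⟨z, ⟨u, hu, hz⟩, hzy⟩

theorem exists_reachIn_of_transGen {x y : X} (h : Relation.TransGen R x y) :
    ∃ n, ReachIn R (n + 1) x y := by
  induction h with
  | single h => exact ⟨0, _, h, rfl⟩
  | tail _ h ih => obtain ⟨n, hn⟩ := ih; exact ⟨n + 1, hn.tail h⟩

end ReachIn

section Cycles

variable {A B O : Type*} {P Q : O → O → Prop} {w : A → B → O}

/-- If five consecutive improvements `(i₀, j) → (i₀, j₀) → (i₁, j₀) → (i₁, j₁) → (i₂, j₁) → (i₂, j₂)`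
cannot be shortened through `(i₀, j₁)` or `(i₂, j₀)`, then the row player does not prefer
`(i₂, j₁)` to `(i₀, j₀)`. -/
theorem PatternFree.not_pref (hF : PatternFree P Q w) (hirr : ∀ o, ¬ P o o)
    (hP : PseudoTransitive P) (hQ : PseudoTransitive Q) {i₀ i₁ i₂ : A} {j j₀ j₁ j₂ : B}
    (hj : j₀ ≠ j₁)
    (h₀ : Q (w i₀ j) (w i₀ j₀)) (h₁ : P (w i₀ j₀) (w i₁ j₀)) (h₂ : Q (w i₁ j₀) (w i₁ j₁))
    (h₃ : P (w i₁ j₁) (w i₂ j₁)) (h₄ : Q (w i₂ j₁) (w i₂ j₂))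
    (hc : Q (w i₀ j) (w i₀ j₁) → ¬ P (w i₀ j₁) (w i₂ j₁))
    (hc' : P (w i₀ j₀) (w i₂ j₀) → ¬ Q (w i₂ j₀) (w i₂ j₂)) :
    ¬ P (w i₀ j₀) (w i₂ j₁) := by
  intro hlt
  have hi₀ : i₀ ≠ i₁ := by rintro rfl; exact hirr _ h₁
  have hi₁ : i₁ ≠ i₂ := by rintro rfl; exact hirr _ h₃
  have low : ¬ Q (w i₀ j) (w i₀ j₁) := by
    intro h
    have hle := hc h
    have e := hP.1 _ _ _ h₃ hle
    exact hF.pub_row _ _ _ _ hi₀ hj h₁ h₂ e (hF.ec _ _ _ _ hi₀ hj h₁ h₂ e) (hP.1 _ _ _ hlt hle)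
  have t₀ : Q (w i₀ j₁) (w i₀ j₀) := hQ.2 _ _ _ low h₀
  have t₂ : ¬ P (w i₁ j₁) (w i₀ j₁) := fun h => hF.ec _ _ _ _ hi₀ hj h₁ h₂ h t₀
  have t₃ : P (w i₀ j₁) (w i₂ j₁) := hP.2 _ _ _ t₂ h₃
  have t₄ : ¬ Q (w i₀ j₁) (w i₁ j₁) := hF.pub_col _ _ _ _ hi₀ hj.symm t₀ h₁ h₂ t₂
  have high : P (w i₀ j₀) (w i₂ j₀) := by
    by_contra h
    have u₁ := hP.2 _ _ _ h h₁
    have u₃ : ¬ Q (w i₂ j₁) (w i₂ j₀) := hF.ec _ _ _ _ hi₁.symm hj u₁ h₂ h₃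
    have u₄ := hF.pub_row _ _ _ _ hi₁.symm hj u₁ h₂ h₃ u₃
    exact h (hP.1 _ _ _ hlt u₄)
  have u₃ : Q (w i₂ j₁) (w i₂ j₀) := hQ.1 _ _ _ h₄ (hc' high)
  have u₁ : ¬ P (w i₂ j₀) (w i₁ j₀) := fun h => hF.ec _ _ _ _ hi₁.symm hj h h₂ h₃ u₃
  have u₂ : ¬ Q (w i₁ j₀) (w i₂ j₀) := hF.pub_col _ _ _ _ hi₁ hj h₂ h₃ u₃ u₁
  have hi : i₀ ≠ i₂ := by rintro rfl; exact hirr _ high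
  exact hF.puc _ _ _ _ hi hj.symm t₃ u₃ t₀ high (hQ.1 _ _ _ (hQ.2 _ _ _ u₂ h₂) t₄)

/-- In a cycle of minimal length, every step makes the row player worse off. -/
theorem PatternFree.pref_of_minimal (hF : PatternFree P Q w) (hirr : ∀ o, ¬ P o o)
    (htP : Transitive P) (hP : PseudoTransitive P) (hQ : PseudoTransitive Q) {n : ℕ}
    (hmin : ∀ m < n, ∀ x, ¬ ReachIn (RowColStep P Q w) (m + 1) x x) {x y : A × B}
    (hxy : RowColStep P Q w x y) (hyx : ReachIn (RowColStep P Q w) n y x) :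
    P (w y.1 y.2) (w x.1 x.2) := by
  have key : ∀ a b, RowColStep P Q w a b → ReachIn (RowColStep P Q w) n b a →
      a.2 ≠ b.2 ∧ Q (w b.1 a.2) (w b.1 b.2) := by
    intro a b hab hba
    have hne : a.2 ≠ b.2 := by
      intro h
      cases n with
      | zero =>
        cases hba
        exact hirr _ hab.1
      | succ n =>
        obtain ⟨c, hbc, hca⟩ := hba
        have hac : RowColStep P Q w a c := by
          refine ⟨htP hab.1 ?_, ?_⟩
          · rw [h]; exact hbc.1
          · rw [h]; exact hbc.2
        exact hmin n (Nat.lt_succ_self n) a ⟨c, hac, hca⟩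
    exact ⟨hne, hab.2.resolve_left hne⟩
  match n, hyx with
  | 0, h => cases h; exact (hirr _ hxy.1).elim
  | 1, ⟨_, hyx, rfl⟩ =>
    obtain ⟨hne, hq⟩ := key x y hxy ⟨_, hyx, rfl⟩
    obtain ⟨-, hq'⟩ := key y _ hyx ⟨_, hxy, rfl⟩
    refine (hF.ec _ _ _ _ ?_ hne hxy.1 hq hyx.1 hq').elim
    intro h
    have := hxy.1
    rw [h] at this
    exact hirr _ this
  | n + 2, ⟨z, hyz, hzx⟩ =>
    obtain ⟨u, hzu, hux⟩ := hzx.exists_last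
    obtain ⟨hne, hq₂⟩ := key x y hxy ⟨z, hyz, hzx⟩
    obtain ⟨-, hq₄⟩ := key y z hyz (hzx.tail hxy)
    obtain ⟨-, hq₀⟩ := key u x hux ⟨y, hxy, z, hyz, hzu⟩
    refine hP.1 _ _ _ hyz.1 (hF.not_pref hirr hP hQ hne hq₀ hxy.1 hq₂ hyz.1 hq₄ ?_ ?_)
    · intro hq hp
      exact hmin (n + 1) (Nat.lt_succ_self _) u
        ⟨(x.1, y.2), ⟨hux.1, Or.inr hq⟩, z, ⟨hp, hyz.2⟩, hzu⟩
    · intro hp hq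
      exact hmin (n + 1) (Nat.lt_succ_self _) x ⟨z, ⟨hp, Or.inr hq⟩, hzx⟩

theorem PatternFree.not_reachIn_self (hF : PatternFree P Q w) (hirr : ∀ o, ¬ P o o)
    (htP : Transitive P) (hP : PseudoTransitive P) (hQ : PseudoTransitive Q) (n : ℕ) :
    ∀ x, ¬ ReachIn (RowColStep P Q w) (n + 1) x x := by
  induction n using Nat.strong_induction_on with
  | _ n hmin =>
    have descent : ∀ m l x y, m + l = n → ReachIn (RowColStep P Q w) (m + 1) x y →
        ReachIn (RowColStep P Q w) l y x → P (w y.1 y.2) (w x.1 x.2) := by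
      intro m
      induction m with
      | zero =>
        rintro l x y hl ⟨_, hxy, rfl⟩ hyx
        obtain rfl : l = n := by omega
        exact hF.pref_of_minimal hirr htP hP hQ hmin hxy hyx
      | succ m ih =>
        rintro l x y hl ⟨z, hxz, hzy⟩ hyx
        have hzx : ReachIn (RowColStep P Q w) n z x := hl ▸ hzy.trans hyx
        exact htP (ih (l + 1) z y (by omega) hzy (hyx.tail hxz))
          (hF.pref_of_minimal hirr htP hP hQ hmin hxz hzx)
    exact fun x hx => hirr _ (descent n 0 x x (Nat.add_zero n) hx rfl)

theorem transGen_rowColStep_of_col (htQ : Transitive Q) {x y : A × B} {j : B}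
    (h : Relation.TransGen (RowColStep P Q w) x y) (hq : Q (w y.1 y.2) (w y.1 j)) :
    Relation.TransGen (RowColStep P Q w) x (y.1, j) := by
  have extend : ∀ z, RowColStep P Q w z y → RowColStep P Q w z (y.1, j) := by
    rintro z ⟨hp, hzy⟩
    refine ⟨hp, Or.inr ?_⟩
    rcases hzy with e | hzy
    · rw [e]; exact hq
    · exact htQ hzy hq
  cases h with
  | single h => exact .single (extend _ h)
  | tail h hlast => exact .tail h (extend _ hlast)

/-- An infinite sequence of improvements in a pattern-free finite matrix in which the row player
moves infinitely often yields an outcome that the row player prefers to itself. -/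
theorem PatternFree.exists_pref_self [Finite A] [Finite B] (hF : PatternFree P Q w)
    (htP : Transitive P) (htQ : Transitive Q) (hP : PseudoTransitive P) (hQ : PseudoTransitive Q)
    (g : ℕ → A × B) (S : Set ℕ) (hS : S.Infinite)
    (hrow : ∀ n ∈ S, (g n).2 = (g (n + 1)).2 ∧
      P (w (g n).1 (g n).2) (w (g (n + 1)).1 (g (n + 1)).2))
    (hcol : ∀ n ∉ S, (g n).1 = (g (n + 1)).1 ∧
      Q (w (g n).1 (g n).2) (w (g (n + 1)).1 (g (n + 1)).2)) :
    ∃ o, P o o := by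
  by_contra! hirr
  have hstep : ∀ n ∈ S, RowColStep P Q w (g n) (g (n + 1)) := by
    intro n hn
    obtain ⟨e, h⟩ := hrow n hn
    exact ⟨by rw [e] at h ⊢; exact h, Or.inl e⟩
  obtain ⟨m, hm, n, -, hmn, heq⟩ := hS.exists_lt_map_eq_of_mapsTo
    (fun n _ => Set.mem_univ (g n)) Set.finite_univ
  have hreach : ∀ n, m + 1 ≤ n → Relation.TransGen (RowColStep P Q w) (g m) (g n) := by
    intro n hn
    induction n, hn using Nat.le_induction with
    | base => exact .single (hstep m hm)
    | succ n _ ih =>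
      by_cases h : n ∈ S
      · exact ih.tail (hstep n h)
      · obtain ⟨e, hq⟩ := hcol n h
        rw [← e] at hq
        have := transGen_rowColStep_of_col htQ ih hq
        rwa [e] at this
  have hcycle := hreach n hmn
  rw [← heq] at hcycle
  obtain ⟨k, hk⟩ := exists_reachIn_of_transGen hcycle
  exact hF.not_reachIn_self hirr htP hP hQ k _ hk

end Cycles

theorem statement2 {Sa Sb O : Type*} [Finite Sa] [Finite Sb]
    (v : Sa × Sb → O) (pa pb : O → O → Prop)
    (hta : Transitive pa) (htb : Transitive pb)
    (hpta : PseudoTransitive pa) (hptb : PseudoTransitive pb)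
    (hforb : ∀ (p : Bool) (w x y z : Sa × Sb),
      ¬ (IsEC v pa pb p w x y z ∨ IsPUB v pa pb p w x y z ∨ IsPUC v pa pb p w x y z))
    (f : ℕ → Sa × Sb) (pl : ℕ → Bool)
    (hstep : ∀ n, Impr v pa pb (pl n) (f n) (f (n + 1)))
    (p : Bool) (hinf : {n | pl n = p}.Infinite) :
    ∃ (k : ℕ) (o : ℕ → O), 0 < k ∧ ∀ i < k, PrefOf pa pb p (o i) (o ((i + 1) % k)) := by
  suffices h : ∃ o, PrefOf pa pb p o o by
    obtain ⟨o, ho⟩ := h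
    exact ⟨1, fun _ => o, one_pos, fun _ _ => ho⟩
  have hEC := fun p w x y z h => hforb p w x y z (Or.inl h)
  have hPUB := fun p w x y z h => hforb p w x y z (Or.inr (Or.inl h))
  have hPUC := fun p w x y z h => hforb p w x y z (Or.inr (Or.inr h))
  cases p with
  | true =>
    have hF : PatternFree pa pb (fun i j => v (i, j)) := by
      constructor
      · intro i i' j j' hi hj h₁ h₂ h₃ h₄
        exact hEC true (i, j) (i', j) (i', j') (i, j')
          ⟨⟨rfl, rfl, rfl, rfl, hi, hj⟩, ⟨rfl, h₁⟩, ⟨rfl, h₂⟩, ⟨rfl, h₃⟩, ⟨rfl, h₄⟩⟩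
      · intro i i' j j' hi hj h₁ h₂ h₃ h₄ h₅
        exact hPUB true (i, j) (i', j) (i', j') (i, j')
          ⟨⟨rfl, rfl, rfl, rfl, hi, hj⟩, ⟨rfl, h₁⟩, ⟨rfl, h₂⟩, ⟨rfl, h₃⟩, h₄, h₅⟩
      · intro i i' j j' hi hj h₁ h₂ h₃ h₄ h₅
        exact hPUB false (i, j) (i, j') (i', j') (i', j)
          ⟨⟨rfl, rfl, rfl, rfl, hj, hi⟩, ⟨rfl, h₁⟩, ⟨rfl, h₂⟩, ⟨rfl, h₃⟩, h₄, h₅⟩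
      · intro i i' j j' hi hj h₁ h₂ h₃ h₄ h₅
        exact hPUC true (i, j) (i', j) (i', j') (i, j')
          ⟨⟨rfl, rfl, rfl, rfl, hi, hj⟩, ⟨rfl, h₁⟩, ⟨rfl, h₂⟩, ⟨rfl, h₃⟩, ⟨rfl, h₄⟩, h₅⟩
    refine hF.exists_pref_self hta htb hpta hptb f _ hinf ?_ ?_
    · intro n hn
      have h := hstep n
      rw [show pl n = true from hn] at h
      exact h
    · intro n hn
      have h := hstep n
      rw [Bool.eq_false_of_not_eq_true hn] at h
      exact h
  | false =>
    have hF : PatternFree pb pa (fun j i => v (i, j)) := by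
      constructor
      · intro j j' i i' hj hi h₁ h₂ h₃ h₄
        exact hEC false (i, j) (i, j') (i', j') (i', j)
          ⟨⟨rfl, rfl, rfl, rfl, hj, hi⟩, ⟨rfl, h₁⟩, ⟨rfl, h₂⟩, ⟨rfl, h₃⟩, ⟨rfl, h₄⟩⟩
      · intro j j' i i' hj hi h₁ h₂ h₃ h₄ h₅
        exact hPUB false (i, j) (i, j') (i', j') (i', j)
          ⟨⟨rfl, rfl, rfl, rfl, hj, hi⟩, ⟨rfl, h₁⟩, ⟨rfl, h₂⟩, ⟨rfl, h₃⟩, h₄, h₅⟩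
      · intro j j' i i' hj hi h₁ h₂ h₃ h₄ h₅
        exact hPUB true (i, j) (i', j) (i', j') (i, j')
          ⟨⟨rfl, rfl, rfl, rfl, hi, hj⟩, ⟨rfl, h₁⟩, ⟨rfl, h₂⟩, ⟨rfl, h₃⟩, h₄, h₅⟩
      · intro j j' i i' hj hi h₁ h₂ h₃ h₄ h₅
        exact hPUC false (i, j) (i, j') (i', j') (i', j)
          ⟨⟨rfl, rfl, rfl, rfl, hj, hi⟩, ⟨rfl, h₁⟩, ⟨rfl, h₂⟩, ⟨rfl, h₃⟩, ⟨rfl, h₄⟩, h₅⟩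
    refine hF.exists_pref_self htb hta hptb hpta (fun n => (f n).swap) _ hinf ?_ ?_
    · intro n hn
      have h := hstep n
      rw [show pl n = false from hn] at h
      exact h
    · intro n hn
      have h := hstep n
      rw [Bool.eq_true_of_not_eq_false hn] at h
      exact h
end

section
/- If a finite two-player game whose preferences ≺_a and ≺_b are strict weak orders contains no forbidden pattern, then the collective improvement relation → terminates: there is no infinite sequence of profiles s_0 → s_1 → s_2 → … (hence every maximal improvement sequence is finite and ends at a Nash equilibrium). -/
section Improvement

variable {Sa Sb O : Type*}

theorem Conv.symm {p : Bool} {s t : Sa × Sb} (h : Conv p s t) : Conv p t s := by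
  cases p <;> exact Eq.symm h

theorem Conv.trans {p : Bool} {s t w : Sa × Sb} (h : Conv p s t) (h' : Conv p t w) :
    Conv p s w := by
  cases p <;> exact Eq.trans h h'

theorem Conv.eq_of_not {p : Bool} {s t : Sa × Sb} (h : Conv p s t) (h' : Conv (!p) s t) :
    s = t := by
  cases p
  · exact Prod.ext h h'
  · exact Prod.ext h' h

theorem exists_conv_corner (p : Bool) (s t : Sa × Sb) : ∃ d, Conv p s d ∧ Conv (!p) d t := by
  cases p
  · exact ⟨(s.1, t.2), rfl, rfl⟩
  · exact ⟨(t.1, s.2), rfl, rfl⟩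

theorem rect_of_conv {p : Bool} {w x y z : Sa × Sb} (hwx : Conv p w x) (hxy : Conv (!p) x y)
    (hyz : Conv p y z) (hzw : Conv (!p) z w) (hne : w ≠ x) (hne' : x ≠ y) :
    Rect p w x y z := by
  cases p
  · exact ⟨hwx, hxy, hyz, hzw, fun h => hne (Prod.ext hwx h), fun h => hne' (Prod.ext h hxy)⟩
  · exact ⟨hwx, hxy, hyz, hzw, fun h => hne (Prod.ext h hwx), fun h => hne' (Prod.ext hxy h)⟩

/-- A strict weak order on the outcomes of finitely many profiles is represented by a payoff
function with natural values. -/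
theorem IsSWO.exists_payoff {S : Type*} [Finite S] {r : O → O → Prop} (hr : IsSWO r)
    (v : S → O) : ∃ u : S → ℕ, ∀ s t, r (v s) (v t) ↔ u s < u t := by
  obtain ⟨irr, tr, inc⟩ := hr
  refine ⟨fun s => Set.ncard {x | r (v x) (v s)}, fun s t => ⟨fun h => ?_, fun h => ?_⟩⟩
  · exact Set.ncard_lt_ncard
      ⟨fun x hx => tr hx h, fun hsub => irr _ (hsub (show r (v s) (v t) from h))⟩
      (Set.toFinite _)
  · by_contra hst
    refine absurd h (not_lt.mpr (Set.ncard_le_ncard (fun x hx => ?_) (Set.toFinite _)))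
    change r (v x) (v t) at hx
    change r (v x) (v s)
    by_contra hxs
    by_cases hsx : r (v s) (v x)
    · exact hst (tr hsx hx)
    · have hts : ¬ r (v t) (v s) := fun hts => hxs (tr hx hts)
      exact (inc ⟨hxs, hsx⟩ ⟨hst, hts⟩).1 hx

/-- An infinite walk in a finite type contains a closed walk, which can be repeated forever; one
of least period admits no shortcut. -/
theorem exists_periodic_of_infinite_walk {S : Type*} [Finite S] {R : S → S → Prop}
    (h : ∃ f : ℕ → S, ∀ n, R (f n) (f (n + 1))) :
    ∃ (N : ℕ) (f : ℕ → S), 0 < N ∧ (∀ n, R (f n) (f (n + 1))) ∧ (∀ n, f (n + N) = f n) ∧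
      ∀ (n : ℕ) (g : ℕ → S), 0 < n → (∀ k, R (g k) (g (k + 1))) → g n = g 0 → N ≤ n := by
  classical
  obtain ⟨f, hf⟩ := h
  have hex : ∃ n, 0 < n ∧ ∃ g : ℕ → S, (∀ k, R (g k) (g (k + 1))) ∧ g n = g 0 := by
    obtain ⟨i, j, hij, hfij⟩ := Finite.exists_ne_map_eq_of_infinite f
    wlog hlt : i < j generalizing i j
    · exact this j i hij.symm hfij.symm (by omega)
    refine ⟨j - i, by omega, fun k => f (i + k), fun k => hf _, ?_⟩
    change f (i + (j - i)) = f (i + 0)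
    rw [Nat.add_sub_of_le hlt.le, ← hfij, Nat.add_zero]
  obtain ⟨hpos, g, hg, hclosed⟩ := Nat.find_spec hex
  refine ⟨Nat.find hex, fun k => g (k % Nat.find hex), hpos, fun k => ?_, fun k => ?_,
    fun n g' hn hg' hcl => Nat.find_min' hex ⟨hn, g', hg', hcl⟩⟩
  · generalize Nat.find hex = N at *
    have hstep := hg (k % N)
    by_cases hlt : k % N + 1 < N
    · have : (k + 1) % N = k % N + 1 := by
        rw [Nat.add_mod, ← Nat.mod_eq_of_lt hlt]
        simp
      simpa only [this] using hstep
    · have heq : k % N + 1 = N := by have := Nat.mod_lt k hpos; omega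
      have : (k + 1) % N = 0 := by
        rw [← Nat.mod_add_mod, heq, Nat.mod_self]
      simp only [this]
      rwa [heq, hclosed] at hstep
  · simp

/-- Termination for payoff functions: `bypass` is the absence of elementary cycles and of
Pareto-useful bypasses, `confluence` that of Pareto-useless confluences. -/
theorem improvement_terminates_of_payoff [Finite Sa] [Finite Sb] (u : Bool → Sa × Sb → ℕ)
    (bypass : ∀ (p : Bool) (w x y z : Sa × Sb), Conv p w x → u p w < u p x →
      Conv (!p) x y → u (!p) x < u (!p) y → Conv p y z → u p y < u p z → Conv (!p) z w →
      u (!p) w ≤ u (!p) z ∧ u p z ≤ u p w)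
    (confluence : ∀ (p : Bool) (w x y z : Sa × Sb), Conv p w x → u p w < u p x →
      Conv (!p) x y → u (!p) x < u (!p) y → Conv (!p) w z → u (!p) w < u (!p) z →
      Conv p z y → u p z < u p y → u (!p) w ≤ u (!p) y) :
    ¬ ∃ f : ℕ → Sa × Sb, ∀ n, ∃ p, Conv p (f n) (f (n + 1)) ∧ u p (f n) < u p (f (n + 1)) := by
  intro h
  obtain ⟨N, f, hN, hstep, hper, hmin⟩ := exists_periodic_of_infinite_walk
    (R := fun s t : Sa × Sb => ∃ p, Conv p s t ∧ u p s < u p t) h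
  choose mover hconv hlt using hstep
  have hN1 : N ≠ 1 := by
    rintro rfl
    have := hlt 0
    rw [hper 0] at this
    omega
  have merge : ∀ m p, Conv p (f m) (f (m + 2)) → ¬ u p (f m) < u p (f (m + 2)) := by
    intro m p hc hl
    have := hmin (N - 1) (fun k => if k = 0 then f m else f (m + k + 1)) (by omega)
      (fun k => ?_) ?_
    · omega
    · rcases k with _ | k
      · exact ⟨p, hc, hl⟩
      · simpa [-Bool.exists_bool] using
          ⟨_, hconv (m + (k + 1) + 1), hlt (m + (k + 1) + 1)⟩
    · have : m + (N - 1) + 1 = m + N := by omega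
      simp [this, hper, show N - 1 ≠ 0 by omega]
  have mover_ne : ∀ m q, Conv q (f (m + 1)) (f (m + 2)) →
      u q (f (m + 1)) < u q (f (m + 2)) → q = !mover m := by
    intro m q hc hl
    by_contra hq
    obtain rfl : q = mover m := by simpa using hq
    exact merge m _ ((hconv m).trans hc) ((hlt m).trans hl)
  have alt : ∀ m, mover (m + 1) = !mover m := fun m =>
    mover_ne m _ (hconv (m + 1)) (hlt (m + 1))
  have hN4 : 4 ≤ N := by
    have hN2 : N ≠ 2 := by
      rintro rfl
      have hc := hconv 1
      rw [alt 0, hper 0] at hc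
      have := hlt 0
      rw [(hconv 0).eq_of_not hc.symm] at this
      omega
    have hN3 : N ≠ 3 := by
      rintro rfl
      have hc := hconv 0
      have hl := hlt 0
      rw [← hper 0, ← hper 1] at hc hl
      have := mover_ne 2 _ hc hl
      simp [alt] at this
    omega
  have shortcut : ∀ m p d, Conv p (f m) d → u p (f m) < u p d → Conv (!p) d (f (m + 4)) →
      ¬ u (!p) d < u (!p) (f (m + 4)) := by
    intro m p d hc hl hc' hl'
    have := hmin (N - 2) (fun k => if k = 0 then f m else if k = 1 then d else f (m + k + 2))
      (by omega) (fun k => ?_) ?_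
    · omega
    · rcases k with _ | _ | k
      · exact ⟨p, hc, hl⟩
      · exact ⟨!p, hc', hl'⟩
      · simpa [-Bool.exists_bool] using
          ⟨_, hconv (m + (k + 1 + 1) + 2), hlt (m + (k + 1 + 1) + 2)⟩
    · have : m + (N - 2) + 2 = m + N := by omega
      simp [this, hper, show N - 2 ≠ 0 by omega, show N - 2 ≠ 1 by omega]
  choose d hd hd' using fun k => exists_conv_corner (mover k) (f (k + 1)) (f (k + 3))
  have c1 : ∀ k, Conv (!mover k) (f (k + 1)) (f (k + 2)) := fun k => alt k ▸ hconv (k + 1)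
  have l1 : ∀ k, u (!mover k) (f (k + 1)) < u (!mover k) (f (k + 2)) :=
    fun k => alt k ▸ hlt (k + 1)
  have c2 : ∀ k, Conv (mover k) (f (k + 2)) (f (k + 3)) := fun k => by
    have := c1 (k + 1)
    rwa [alt, Bool.not_not] at this
  have l2 : ∀ k, u (mover k) (f (k + 2)) < u (mover k) (f (k + 3)) := fun k => by
    have := l1 (k + 1)
    rwa [alt, Bool.not_not] at this
  have c3 : ∀ k, Conv (!mover k) (f (k + 3)) (f (k + 4)) := fun k => alt k ▸ c2 (k + 1)
  have l3 : ∀ k, u (!mover k) (f (k + 3)) < u (!mover k) (f (k + 4)) :=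
    fun k => alt k ▸ l2 (k + 1)
  have low : ∀ k, u (mover k) (d k) ≤ u (mover k) (f k) →
      u (!mover k) (d k) ≤ u (!mover k) (f (k + 3)) ∧
        u (mover k) (f (k + 3)) ≤ u (mover k) (d k) := fun k hk =>
    bypass (mover k) (d k) (f (k + 1)) (f (k + 2)) (f (k + 3)) (hd k).symm
      (hk.trans_lt (hlt k)) (c1 k) (l1 k) (c2 k) (l2 k) (hd' k).symm
  have high : ∀ k, ¬ u (mover k) (d k) ≤ u (mover k) (f k) →
      u (!mover k) (f (k + 4)) ≤ u (!mover k) (d k) ∧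
        u (mover k) (f (k + 1)) ≤ u (mover k) (d k) ∧
        u (!mover k) (d k) ≤ u (!mover k) (f (k + 1)) := by
    intro k hk
    have h4 := not_lt.mp (shortcut k _ (d k) ((hconv k).trans (hd k)) (not_le.mp hk)
      ((hd' k).trans (c3 k)))
    have := bypass (!mover k) (f (k + 1)) (f (k + 2)) (f (k + 3)) (d k) (c1 k) (l1 k)
      (by simpa using c2 k) (by simpa using l2 k) (hd' k).symm ((l3 k).trans_le h4)
      (by simpa using (hd k).symm)
    rw [Bool.not_not] at this
    exact ⟨h4, this⟩
  have low_succ : ∀ k, u (mover k) (d k) ≤ u (mover k) (f k) →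
      u (mover (k + 1)) (d (k + 1)) ≤ u (mover (k + 1)) (f (k + 1)) := by
    intro k hk
    by_contra hk'
    obtain ⟨e1, e2, e3⟩ := high (k + 1) hk'
    have b1 := hd (k + 1)
    have b2 := hd' (k + 1)
    rw [alt] at e2 b1
    rw [alt, Bool.not_not] at e1 e3 b2
    obtain ⟨g1, g2⟩ := low k hk
    have m1 := hlt k
    have m2 := l1 k
    have m3 := l2 k
    have m4 := l3 k
    have m5 := l3 (k + 1)
    rw [alt, Bool.not_not] at m5
    have := confluence (!mover k) (d k) (f (k + 4)) (d (k + 1)) (f (k + 1))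
      ((hd' k).trans (c3 k)) (g1.trans_lt m4) (by simpa using b2.symm)
      (by simpa using m5.trans_le e1) (by simpa using (hd k).symm)
      (by simpa using hk.trans_lt m1) ((c1 k).trans b1) (m2.trans_le e2)
    rw [Bool.not_not] at this
    exact absurd (m3.trans_le (g2.trans (this.trans e3))) (lt_irrefl _)
  have mover_even : ∀ k i, mover (k + 2 * i) = mover k := by
    intro k i
    induction i with
    | zero => rfl
    | succ i ih => rw [show k + 2 * (i + 1) = k + 2 * i + 1 + 1 by ring, alt, alt, ih,
        Bool.not_not]
  by_cases hlow : ∃ k, u (mover k) (d k) ≤ u (mover k) (f k)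
  · obtain ⟨k, hk⟩ := hlow
    have hall : ∀ i, u (mover (k + i)) (d (k + i)) ≤ u (mover (k + i)) (f (k + i)) := by
      intro i
      induction i with
      | zero => exact hk
      | succ i ih => exact low_succ _ ih
    refine not_strictAnti_of_wellFoundedLT (fun i => u (mover k) (f (k + 2 * i)))
      (strictAnti_nat_of_succ_lt fun i => ?_)
    have := (l2 (k + 2 * i)).trans_le ((low _ (hall (2 * i))).2.trans (hall (2 * i)))
    rwa [mover_even] at this
  · refine not_strictAnti_of_wellFoundedLT (fun i => u (!mover 0) (f (0 + 2 * i + 1)))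
      (strictAnti_nat_of_succ_lt fun i => ?_)
    obtain ⟨e1, -, e3⟩ := high (0 + 2 * i) fun h => hlow ⟨_, h⟩
    have := (l3 (0 + 2 * i)).trans_le (e1.trans e3)
    rwa [mover_even] at this

end Improvement

theorem statement3 {Sa Sb O : Type*} [Finite Sa] [Finite Sb]
    (v : Sa × Sb → O) (pa pb : O → O → Prop)
    (hswa : IsSWO pa) (hswb : IsSWO pb)
    (hforb : ∀ (p : Bool) (w x y z : Sa × Sb),
      ¬ (IsEC v pa pb p w x y z ∨ IsPUB v pa pb p w x y z ∨ IsPUC v pa pb p w x y z)) :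
    ¬ ∃ f : ℕ → Sa × Sb, ∀ n, Step v pa pb (f n) (f (n + 1)) := by
  have hpref : ∀ p, IsSWO (PrefOf pa pb p) := fun p => by
    cases p
    · exact hswb
    · exact hswa
  choose u hu using fun p => (hpref p).exists_payoff v
  have ne_of_lt : ∀ {p s t}, u p s < u p t → s ≠ t := by
    rintro p s _ h rfl
    exact lt_irrefl _ h
  have key := improvement_terminates_of_payoff u ?_ ?_
  · simpa only [Step, Impr, hu] using key
  · intro p w x y z hwx lwx hxy lxy hyz lyz hzw
    have hR := rect_of_conv hwx hxy hyz hzw (ne_of_lt lwx) (ne_of_lt lxy)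
    have hno := hforb p w x y z
    simp only [IsEC, IsPUB, Impr, Ple, hu, hR, hwx, hxy, hyz, hzw, lwx, lxy, lyz, true_and,
      not_or, not_and, not_lt] at hno
    exact ⟨hno.1, hno.2.1 hno.1⟩
  · intro p w x y z hwx lwx hxy lxy hwz lwz hzy lzy
    have hR := rect_of_conv hwx hxy hzy.symm hwz.symm (ne_of_lt lwx) (ne_of_lt lxy)
    have hno := hforb p w x y z
    simp only [IsPUC, Impr, hu, hR, hwx, hxy, hwz, hzy, lwx, lxy, lwz, lzy, true_and,
      not_or, not_lt] at hno
    exact hno.2.2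
end

section
/- Let ⟨S_a, S_b, O, v⟩ be a finite two-player game structure. The following are equivalent: (1) the structure has no forbidden rectangle, i.e., for all strategies s_a¹, s_a² ∈ S_a and s_b¹, s_b² ∈ S_b, either v(s_a¹,s_b¹) = v(s_a²,s_b¹), or v(s_a²,s_b¹) = v(s_a²,s_b²), or v(s_a²,s_b²) = v(s_a¹,s_b²), or v(s_a¹,s_b²) = v(s_a¹,s_b¹); (2) for all acyclic preference relations ≺_a, ≺_b on O, the induced game has no improvement cycle of length four, i.e., no profiles with s_1 → s_2 → s_3 → s_4 → s_1; (3) for all acyclic preference relations ≺_a, ≺_b on O, the induced game has no improvement cycle of any length; (4) for all acyclic preference relations ≺_a, ≺_b on O, every subgame of the induced game (the restriction of v and of the improvement dynamics to S'_a × S'_b for nonempty subsets S'_a ⊆ S_a, S'_b ⊆ S_b) has a Nash equilibrium. -/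
/-- An acyclic relation embeds into the strict order of some linear order. -/
theorem exists_linearOrder_of_acyclic.{u} {O : Type u} (r : O → O → Prop)
    (hr : ∀ o, ¬ Relation.TransGen r o o) :
    ∃ (A : Type u) (_ : LinearOrder A) (f : O → A),
      ∀ x y, r x y → f x < f y := by
  let _ : PartialOrder O :=
    { le := Relation.ReflTransGen r
      le_refl := fun _ => Relation.ReflTransGen.refl
      le_trans := fun _ _ _ => Relation.ReflTransGen.trans
      le_antisymm := fun a b hab hba => by
        rcases Relation.reflTransGen_iff_eq_or_transGen.1 hab with h | h
        · exact h.symm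
        · exact absurd (h.trans_left hba) (hr a) }
  refine ⟨LinearExtension O, inferInstance, toLinearExtension, fun x y hxy => ?_⟩
  have hle : x ≤ y := Relation.ReflTransGen.single hxy
  refine lt_of_le_of_ne (toLinearExtension.monotone hle) fun h => ?_
  have hxy' : x = y := h
  subst hxy'
  exact hr x (Relation.TransGen.single hxy)

/-- A relation with a closed walk has a periodic walk of some period `n` admitting neither a
shortcut of two steps by one, nor (when `4 ≤ n`) of four steps by two. -/
theorem exists_periodic_walk {α : Type*} (R : α → α → Prop)
    (h : ∃ (k : ℕ) (f : ℕ → α), 0 < k ∧ f k = f 0 ∧ ∀ i < k, R (f i) (f (i + 1))) :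
    ∃ (n : ℕ) (s : ℕ → α), 0 < n ∧ (∀ i, s (i + n) = s i) ∧ (∀ i, R (s i) (s (i + 1))) ∧
      (2 ≤ n → ∀ i, ¬ R (s i) (s (i + 2))) ∧
      (4 ≤ n → ∀ i t, R (s i) t → ¬ R t (s (i + 4))) := by
  classical
  obtain ⟨f, hn, hf0, hf⟩ := Nat.find_spec h
  have hmin := fun m (hm : m < Nat.find h) => Nat.find_min h hm
  generalize Nat.find h = n at f hn hf0 hf hmin
  have hper : ∀ i, f ((i + n) % n) = f (i % n) := fun i => by rw [Nat.add_mod_right]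
  have hstep : ∀ i, R (f (i % n)) (f ((i + 1) % n)) := fun i => by
    have hlt : i % n < n := Nat.mod_lt _ hn
    have hstep' := hf _ hlt
    rcases Nat.lt_or_ge (i % n + 1) n with h1 | h1
    · rwa [show (i + 1) % n = i % n + 1 by rw [← Nat.mod_add_mod, Nat.mod_eq_of_lt h1]]
    · have h2 : i % n + 1 = n := by omega
      rw [h2, hf0] at hstep'
      rwa [show (i + 1) % n = 0 by rw [← Nat.mod_add_mod, h2, Nat.mod_self]]
  generalize hs : (fun i => f (i % n)) = s
  have hs' : ∀ i, f (i % n) = s i := fun i => congrFun hs i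
  simp only [hs'] at hper hstep
  refine ⟨n, s, hn, hper, hstep, fun h2 i hi => ?_, fun h4 i t h1 h2 => ?_⟩
  · refine hmin (n - 1) (by omega)
      ⟨fun j => if j = 0 then s i else s (i + j + 1), by omega, ?_, fun j hj => ?_⟩
    · change (if _ then _ else _) = s i
      rw [if_neg (by omega), show i + (n - 1) + 1 = i + n by omega, hper]
    · rcases Nat.eq_zero_or_pos j with rfl | hj0
      · simpa using hi
      · simpa [hj0.ne', add_assoc] using hstep (i + j + 1)
  · refine hmin (n - 2) (by omega)
      ⟨fun j => if j = 0 then s i else if j = 1 then t else s (i + j + 2), by omega, ?_,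
        fun j hj => ?_⟩
    · change (if _ then _ else if _ then _ else _) = s i
      rw [if_neg (by omega), if_neg (by omega),
        show i + (n - 2) + 2 = i + n by omega, hper]
    · match j with
      | 0 => simpa using h1
      | 1 => simpa using h2
      | j + 2 => simpa [add_assoc, add_comm, add_left_comm] using hstep (i + (j + 2) + 2)

/-- The structure has no forbidden rectangle. -/
def RectangleFree {Sa Sb O : Type*} (v : Sa × Sb → O) : Prop :=
  ∀ (sa1 sa2 : Sa) (sb1 sb2 : Sb),
    v (sa1, sb1) = v (sa2, sb1) ∨ v (sa2, sb1) = v (sa2, sb2) ∨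
    v (sa2, sb2) = v (sa1, sb2) ∨ v (sa1, sb2) = v (sa1, sb1)

/-- Along five alternating improvement steps without shortcuts, the outcome reached by the
fourth step is no better for player `a` than the outcome reached by the first one. -/
theorem RectangleFree.le_of_no_shortcut {Sa Sb O A B : Type*} [LinearOrder A] [LinearOrder B]
    {v : Sa × Sb → O} (hv : RectangleFree v) {fa : O → A} {fb : O → B}
    {r₁ r₂ r₃ : Sa} {c₀ c₁ c₂ c₃ : Sb}
    (h₀ : fb (v (r₁, c₀)) < fb (v (r₁, c₁))) (h₁ : fa (v (r₁, c₁)) < fa (v (r₂, c₁)))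
    (h₂ : fb (v (r₂, c₁)) < fb (v (r₂, c₂))) (h₃ : fa (v (r₂, c₂)) < fa (v (r₃, c₂)))
    (h₄ : fb (v (r₃, c₂)) < fb (v (r₃, c₃)))
    (hb : fb (v (r₁, c₀)) < fb (v (r₁, c₂)) → ¬ fa (v (r₁, c₂)) < fa (v (r₃, c₂)))
    (ha : fa (v (r₁, c₁)) < fa (v (r₃, c₁)) → ¬ fb (v (r₃, c₁)) < fb (v (r₃, c₃))) :
    fa (v (r₃, c₂)) ≤ fa (v (r₁, c₁)) := by
  by_contra! hlt
  have e₁ := hv r₁ r₂ c₁ c₂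
  have e₂ := hv r₂ r₃ c₁ c₂
  have e₃ := hv r₁ r₃ c₁ c₂
  grind

/-- With linear preferences, a rectangle-free structure has no improvement cycle. -/
theorem RectangleFree.no_cycle_of_linearOrder {Sa Sb O A B : Type*} [LinearOrder A]
    [LinearOrder B] {v : Sa × Sb → O} (hv : RectangleFree v) (fa : O → A) (fb : O → B) :
    ¬ ∃ (k : ℕ) (f : ℕ → Sa × Sb), 0 < k ∧ f k = f 0 ∧ ∀ i < k,
      Step v (fun x y => fa x < fa y) (fun x y => fb x < fb y) (f i) (f (i + 1)) := by
  intro h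
  have step_iff : ∀ s t, Step v (fun x y => fa x < fa y) (fun x y => fb x < fb y) s t ↔
      (s.2 = t.2 ∧ fa (v s) < fa (v t)) ∨ (s.1 = t.1 ∧ fb (v s) < fb (v t)) := fun s t => by
    simp [Step, Impr, Conv, PrefOf, or_comm]
  obtain ⟨n, s, hn, hper, hstep, h2, h4⟩ := exists_periodic_walk _ h
  simp only [step_iff] at hstep h2 h4
  have hn1 : n ≠ 1 := by
    rintro rfl
    have := hstep 0
    rw [hper 0] at this
    simp at this
  have h2' := h2 (by omega)
  have hAB : ∀ i, (s i).2 = (s (i + 1)).2 → fa (v (s i)) < fa (v (s (i + 1))) →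
      (s (i + 1)).1 = (s (i + 2)).1 ∧ fb (v (s (i + 1))) < fb (v (s (i + 2))) := by
    intro i e l
    rcases hstep (i + 1) with h | h
    · exact absurd (Or.inl ⟨e.trans h.1, l.trans h.2⟩) (h2' i)
    · exact h
  have hBA : ∀ i, (s i).1 = (s (i + 1)).1 → fb (v (s i)) < fb (v (s (i + 1))) →
      (s (i + 1)).2 = (s (i + 2)).2 ∧ fa (v (s (i + 1))) < fa (v (s (i + 2))) := by
    intro i e l
    rcases hstep (i + 1) with h | h
    · exact h
    · exact absurd (Or.inr ⟨e.trans h.1, l.trans h.2⟩) (h2' i)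
  obtain ⟨m, hm⟩ : ∃ m, (s m).1 = (s (m + 1)).1 ∧ fb (v (s m)) < fb (v (s (m + 1))) := by
    rcases hstep 0 with h | h
    · exact ⟨1, hAB 0 h.1 h.2⟩
    · exact ⟨0, h⟩
  have hB : ∀ i, (s (m + 2 * i)).1 = (s (m + 2 * i + 1)).1 ∧
      fb (v (s (m + 2 * i))) < fb (v (s (m + 2 * i + 1))) := by
    intro i
    induction i with
    | zero => exact hm
    | succ i ih =>
      have h := hBA _ ih.1 ih.2
      exact hAB _ h.1 h.2
  have hn2 : n ≠ 2 := by
    rintro rfl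
    have h := hBA _ hm.1 hm.2
    rw [hper m] at h
    have e : s m = s (m + 1) := Prod.ext hm.1 h.1.symm
    exact absurd hm.2 (by rw [e]; exact lt_irrefl _)
  have hn3 : n ≠ 3 := by
    rintro rfl
    have h := hB 1
    have h' := hBA _ hm.1 hm.2
    have h'' := hAB _ h'.1 h'.2
    have e : s (m + 2 + 1) = s m := hper m
    have e' : s (m + 2 + 2) = s (m + 1) := hper (m + 1)
    have h3 := hBA _ h''.1 h''.2
    simp only [show m + 1 + 1 + 1 = m + 2 + 1 from rfl, show m + 1 + 1 + 2 = m + 2 + 2 from rfl,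
      e, e'] at h3
    have e4 : s m = s (m + 1) := Prod.ext hm.1 h3.1
    exact absurd hm.2 (by rw [e4]; exact lt_irrefl _)
  have h4' := h4 (by omega)
  have hdec : StrictAnti fun i => fa (v (s (m + 2 * i + 1))) := by
    refine strictAnti_nat_of_succ_lt fun i => ?_
    have b₀ := hB i
    have a₁ := hBA _ b₀.1 b₀.2
    have b₂ := hAB _ a₁.1 a₁.2
    have a₃ := hBA _ b₂.1 b₂.2
    have b₄ := hAB _ a₃.1 a₃.2
    have hb := h4' (m + 2 * i) ((s (m + 2 * i)).1, (s (m + 2 * i + 3)).2)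
    have ha := h4' (m + 2 * i + 1) ((s (m + 2 * i + 4)).1, (s (m + 2 * i + 1)).2)
    rw [show m + 2 * (i + 1) + 1 = m + 2 * i + 3 by omega]
    simp only [add_assoc, Nat.reduceAdd] at a₁ b₂ a₃ b₄ b₀ hb ha ⊢
    generalize m + (2 * i + 1) = j₁, m + (2 * i + 2) = j₂, m + (2 * i + 3) = j₃,
      m + (2 * i + 4) = j₄, m + (2 * i + 5) = j₅, m + 2 * i = j₀ at *
    generalize s j₀ = s₀, s j₁ = s₁, s j₂ = s₂, s j₃ = s₃, s j₄ = s₄, s j₅ = s₅ at *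
    obtain ⟨r₁, c₀⟩ := s₀
    obtain ⟨_, c₁⟩ := s₁
    obtain ⟨r₂, _⟩ := s₂
    obtain ⟨_, c₂⟩ := s₃
    obtain ⟨r₃, _⟩ := s₄
    obtain ⟨_, c₃⟩ := s₅
    obtain ⟨rfl, b₀⟩ := b₀
    obtain ⟨rfl, a₁⟩ := a₁
    obtain ⟨rfl, b₂⟩ := b₂
    obtain ⟨rfl, a₃⟩ := a₃
    obtain ⟨rfl, b₄⟩ := b₄
    exact a₃.trans_le <| hv.le_of_no_shortcut b₀ a₁ b₂ a₃ b₄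
      (fun h h' => hb (.inr ⟨trivial, h⟩) (.inl ⟨rfl, h'⟩))
      (fun h h' => ha (.inl ⟨trivial, h⟩) (.inr ⟨rfl, h'⟩))
  have := hdec (show 0 < n from hn)
  have e : ∀ i, s (m + 1 + i * n) = s (m + 1) := fun i => by
    induction i with
    | zero => simp
    | succ i ih => rw [Nat.succ_mul, ← add_assoc, hper, ih]
  have e2 := e 2
  rw [show m + 1 + 2 * n = m + 2 * n + 1 by omega] at e2
  simp [e2] at this

theorem RectangleFree.no_cycle {Sa Sb O : Type*} {v : Sa × Sb → O} (hv : RectangleFree v)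
    {pa pb : O → O → Prop} (ha : ∀ o, ¬ Relation.TransGen pa o o)
    (hb : ∀ o, ¬ Relation.TransGen pb o o) :
    ¬ ∃ (k : ℕ) (f : ℕ → Sa × Sb), 0 < k ∧ f k = f 0 ∧
      ∀ i < k, Step v pa pb (f i) (f (i + 1)) := by
  obtain ⟨A, _, fa, hfa⟩ := exists_linearOrder_of_acyclic pa ha
  obtain ⟨B, _, fb, hfb⟩ := exists_linearOrder_of_acyclic pb hb
  rintro ⟨k, f, hk, hf0, hf⟩
  refine hv.no_cycle_of_linearOrder fa fb ⟨k, f, hk, hf0, fun i hi => ?_⟩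
  obtain ⟨p, hc, hp⟩ := hf i hi
  refine ⟨p, hc, ?_⟩
  cases p
  · exact hfb _ _ hp
  · exact hfa _ _ hp

theorem not_transGen_self_of_not_comp {α : Type*} {r : α → α → Prop}
    (h : ∀ x y z, r x y → ¬ r y z) (o : α) : ¬ Relation.TransGen r o o := by
  have key : ∀ x y, Relation.TransGen r x y → r x y := by
    intro x y hxy
    induction hxy with
    | single h1 => exact h1
    | tail _ h1 ih => exact absurd h1 (h _ _ _ ih)
  exact fun ho => h _ _ _ (key _ _ ho) (key _ _ ho)

/-- A forbidden rectangle is an improvement cycle for some acyclic preferences. -/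
theorem exists_cycle_of_not_rectangleFree {Sa Sb O : Type*} {v : Sa × Sb → O}
    (hv : ¬ RectangleFree v) :
    ∃ pa pb : O → O → Prop, (∀ o, ¬ Relation.TransGen pa o o) ∧
      (∀ o, ¬ Relation.TransGen pb o o) ∧ ∃ (r₁ r₂ : Sa) (c₁ c₂ : Sb),
        Impr v pa pb true (r₁, c₁) (r₂, c₁) ∧ Impr v pa pb false (r₂, c₁) (r₂, c₂) ∧
        Impr v pa pb true (r₂, c₂) (r₁, c₂) ∧ Impr v pa pb false (r₁, c₂) (r₁, c₁) := by
  simp only [RectangleFree, not_forall, not_or] at hv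
  obtain ⟨r₁, r₂, c₁, c₂, h₁, h₂, h₃, h₄⟩ := hv
  refine ⟨fun x y => (x = v (r₁, c₁) ∧ y = v (r₂, c₁)) ∨ (x = v (r₂, c₂) ∧ y = v (r₁, c₂)),
    fun x y => (x = v (r₂, c₁) ∧ y = v (r₂, c₂)) ∨ (x = v (r₁, c₂) ∧ y = v (r₁, c₁)),
    not_transGen_self_of_not_comp (by grind), not_transGen_self_of_not_comp (by grind),
    r₁, r₂, c₁, c₂, ?_⟩
  simp [Impr, Conv, PrefOf]

/-- On a nonempty finite type, a relation without closed walks has a sink. -/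
theorem exists_sink_of_no_closed_walk {α : Type*} [Finite α] [Nonempty α] {R : α → α → Prop}
    (h : ¬ ∃ (k : ℕ) (f : ℕ → α), 0 < k ∧ f k = f 0 ∧ ∀ i < k, R (f i) (f (i + 1))) :
    ∃ x, ∀ y, ¬ R x y := by
  by_contra! hR
  choose g hg using hR
  obtain ⟨x⟩ := ‹Nonempty α›
  obtain ⟨i, j, hij, he⟩ :=
    Finite.exists_ne_map_eq_of_infinite fun i : ℕ => g^[i] x
  wlog hlt : i < j generalizing i j
  · exact this j i hij.symm he.symm (by omega)
  refine h ⟨j - i, fun m => g^[i + m] x, by omega, ?_, fun m _ => ?_⟩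
  · simpa [Nat.add_sub_cancel' hlt.le] using he.symm
  · change R (g^[i + m] x) (g^[i + m + 1] x)
    rw [Function.iterate_succ_apply']
    exact hg _

theorem statement6 {Sa Sb O : Type*} [Fintype Sa] [Fintype Sb] [Nonempty Sa] [Nonempty Sb]
    (v : Sa × Sb → O) :
    -- (1) ↔ (2)
    ((∀ (sa1 sa2 : Sa) (sb1 sb2 : Sb),
        v (sa1, sb1) = v (sa2, sb1) ∨ v (sa2, sb1) = v (sa2, sb2) ∨
        v (sa2, sb2) = v (sa1, sb2) ∨ v (sa1, sb2) = v (sa1, sb1)) ↔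
      (∀ pa pb : O → O → Prop,
        (∀ o, ¬ Relation.TransGen pa o o) → (∀ o, ¬ Relation.TransGen pb o o) →
        ¬ ∃ t1 t2 t3 t4 : Sa × Sb, Step v pa pb t1 t2 ∧ Step v pa pb t2 t3 ∧
          Step v pa pb t3 t4 ∧ Step v pa pb t4 t1)) ∧
    -- (1) ↔ (3)
    ((∀ (sa1 sa2 : Sa) (sb1 sb2 : Sb),
        v (sa1, sb1) = v (sa2, sb1) ∨ v (sa2, sb1) = v (sa2, sb2) ∨
        v (sa2, sb2) = v (sa1, sb2) ∨ v (sa1, sb2) = v (sa1, sb1)) ↔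
      (∀ pa pb : O → O → Prop,
        (∀ o, ¬ Relation.TransGen pa o o) → (∀ o, ¬ Relation.TransGen pb o o) →
        ¬ ∃ (k : ℕ) (f : ℕ → Sa × Sb), 0 < k ∧ f k = f 0 ∧
          ∀ i < k, Step v pa pb (f i) (f (i + 1)))) ∧
    -- (1) ↔ (4)
    ((∀ (sa1 sa2 : Sa) (sb1 sb2 : Sb),
        v (sa1, sb1) = v (sa2, sb1) ∨ v (sa2, sb1) = v (sa2, sb2) ∨
        v (sa2, sb2) = v (sa1, sb2) ∨ v (sa1, sb2) = v (sa1, sb1)) ↔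
      (∀ pa pb : O → O → Prop,
        (∀ o, ¬ Relation.TransGen pa o o) → (∀ o, ¬ Relation.TransGen pb o o) →
        ∀ (Ta : Set Sa) (Tb : Set Sb), Ta.Nonempty → Tb.Nonempty →
        ∃ s : Sa × Sb, s.1 ∈ Ta ∧ s.2 ∈ Tb ∧
          ∀ (p : Bool) (s' : Sa × Sb), s'.1 ∈ Ta → s'.2 ∈ Tb →
            ¬ Impr v pa pb p s s')) := by
  have h3 : RectangleFree v → ∀ pa pb : O → O → Prop,
      (∀ o, ¬ Relation.TransGen pa o o) → (∀ o, ¬ Relation.TransGen pb o o) →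
      ¬ ∃ (k : ℕ) (f : ℕ → Sa × Sb), 0 < k ∧ f k = f 0 ∧
        ∀ i < k, Step v pa pb (f i) (f (i + 1)) := fun hv _ _ ha hb => hv.no_cycle ha hb
  have closed : ∀ {pa pb : O → O → Prop} {t1 t2 t3 t4 : Sa × Sb}, Step v pa pb t1 t2 →
      Step v pa pb t2 t3 → Step v pa pb t3 t4 → Step v pa pb t4 t1 →
      ∃ (k : ℕ) (f : ℕ → Sa × Sb), 0 < k ∧ f k = f 0 ∧
        ∀ i < k, Step v pa pb (f i) (f (i + 1)) := by
    intro pa pb t1 t2 t3 t4 h12 h23 h34 h41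
    refine ⟨4, fun i => if i = 1 then t2 else if i = 2 then t3 else if i = 3 then t4 else t1,
      by norm_num, by simp, fun i hi => ?_⟩
    interval_cases i <;> simpa
  refine ⟨⟨fun hv pa pb ha hb => ?_, fun h => ?_⟩, ⟨h3, fun h => ?_⟩,
    ⟨fun hv pa pb ha hb Ta Tb hTa hTb => ?_, fun h => ?_⟩⟩
  · rintro ⟨t1, t2, t3, t4, h12, h23, h34, h41⟩
    exact h3 hv pa pb ha hb (closed h12 h23 h34 h41)
  · by_contra hv
    obtain ⟨pa, pb, ha, hb, r₁, r₂, c₁, c₂, h12, h23, h34, h41⟩ :=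
      exists_cycle_of_not_rectangleFree hv
    exact h pa pb ha hb ⟨_, _, _, _, ⟨_, h12⟩, ⟨_, h23⟩, ⟨_, h34⟩, ⟨_, h41⟩⟩
  · by_contra hv
    obtain ⟨pa, pb, ha, hb, r₁, r₂, c₁, c₂, h12, h23, h34, h41⟩ :=
      exists_cycle_of_not_rectangleFree hv
    exact h pa pb ha hb (closed ⟨_, h12⟩ ⟨_, h23⟩ ⟨_, h34⟩ ⟨_, h41⟩)
  · have : Nonempty (Ta ×ˢ Tb : Set (Sa × Sb)) := (hTa.prod hTb).to_subtype
    obtain ⟨⟨s, hs⟩, hsink⟩ := exists_sink_of_no_closed_walk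
      (R := fun s t : (Ta ×ˢ Tb : Set (Sa × Sb)) => Step v pa pb s t)
      (fun ⟨k, f, hk, hf0, hf⟩ => h3 hv pa pb ha hb
        ⟨k, fun i => f i, hk, congrArg Subtype.val hf0, hf⟩)
    exact ⟨s, hs.1, hs.2, fun p s' ha' hb' hi => hsink ⟨s', ha', hb'⟩ ⟨p, hi⟩⟩
  · by_contra hv
    obtain ⟨pa, pb, ha, hb, r₁, r₂, c₁, c₂, h12, h23, h34, h41⟩ :=
      exists_cycle_of_not_rectangleFree hv
    obtain ⟨⟨r, c⟩, hr, hc, hs⟩ := h pa pb ha hb {r₁, r₂} {c₁, c₂} (by simp) (by simp)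
    simp only [Set.mem_insert_iff, Set.mem_singleton_iff] at hr hc
    rcases hr with rfl | rfl <;> rcases hc with rfl | rfl
    · exact hs _ _ (by simp) (by simp) h12
    · exact hs _ _ (by simp) (by simp) h41
    · exact hs _ _ (by simp) (by simp) h23
    · exact hs _ _ (by simp) (by simp) h34
end

section
/- Let n ≥ 1, let S_1, …, S_n be compact topological spaces, let S = ∏_{i=1}^n S_i carry the product topology, let f : S → ℝ^n be continuous, and let ε > 0. Then there exist m ≥ 1 and, for each i ∈ {1,…,n}, pairwise disjoint subsets S_{i,1}, …, S_{i,m} of S_i whose union is S_i, such that for every function j : {1,…,n} → {1,…,m} and all x, y ∈ ∏_{i=1}^n S_{i,j(i)}, every coordinate k ∈ {1,…,n} satisfies |f(x)_k − f(y)_k| < ε. -/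
/-- On a finite product of compact spaces, every continuous map to a pseudometric space oscillates
by less than `ε` along the cells cut out by finite-valued colourings of the factors. -/
theorem Continuous.exists_finite_colouring_dist_lt {ι : Type*} [Finite ι] {S : ι → Type*}
    [∀ i, TopologicalSpace (S i)] [∀ i, CompactSpace (S i)]
    {E : Type*} [PseudoMetricSpace E] {f : (∀ i, S i) → E} (hf : Continuous f)
    {ε : ℝ} (hε : 0 < ε) :
    ∃ m : ℕ, 1 ≤ m ∧ ∃ c : ∀ i, S i → Fin m,
      ∀ x y : ∀ i, S i, (∀ i, c i (x i) = c i (y i)) → dist (f x) (f y) < ε := by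
  classical
  have hbox (p : ∀ i, S i) : ∃ u : ∀ i, Set (S i), (∀ i, IsOpen (u i) ∧ p i ∈ u i) ∧
      Set.univ.pi u ⊆ f ⁻¹' Metric.ball (f p) (ε / 2) :=
    isOpen_pi_iff'.1 (Metric.isOpen_ball.preimage hf) p (Metric.mem_ball_self (half_pos hε))
  choose u hu hsub using hbox
  obtain ⟨t, ht⟩ := CompactSpace.elim_nhds_subcover (fun p => Set.univ.pi (u p)) fun p =>
    set_pi_mem_nhds Set.finite_univ fun i _ => (hu p i).1.mem_nhds (hu p i).2
  let e := Fintype.equivFin (Set t)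
  refine ⟨Fintype.card (Set t), Fintype.card_pos, fun i s => e {p | s ∈ u p i}, ?_⟩
  intro x y hxy
  have hx : x ∈ ⋃ p ∈ t, Set.univ.pi (u p) := ht ▸ Set.mem_univ x
  obtain ⟨p, hp, hxp⟩ := Set.mem_iUnion₂.1 hx
  have hyp : y ∈ Set.univ.pi (u p) := fun i _ =>
    (Set.ext_iff.1 (e.injective (hxy i)) ⟨p, hp⟩).1 (hxp i trivial)
  have h₁ : dist (f x) (f p) < ε / 2 := hsub p hxp
  have h₂ : dist (f y) (f p) < ε / 2 := hsub p hyp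
  linarith [dist_triangle_right (f x) (f y) (f p)]

theorem statement7 {n : ℕ} (hn : 1 ≤ n) (S : Fin n → Type*)
    [∀ i, TopologicalSpace (S i)] [∀ i, CompactSpace (S i)]
    (f : (∀ i, S i) → (Fin n → ℝ)) (hf : Continuous f) (ε : ℝ) (hε : 0 < ε) :
    ∃ m : ℕ, 1 ≤ m ∧ ∃ P : (i : Fin n) → Fin m → Set (S i),
      (∀ i, ∀ j j' : Fin m, j ≠ j' → Disjoint (P i j) (P i j')) ∧
      (∀ i, (⋃ j, P i j) = Set.univ) ∧
      (∀ (j : Fin n → Fin m) (x y : ∀ i, S i),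
        (∀ i, x i ∈ P i (j i)) → (∀ i, y i ∈ P i (j i)) →
        ∀ k : Fin n, |f x k - f y k| < ε) := by
  obtain ⟨m, hm, c, hc⟩ := hf.exists_finite_colouring_dist_lt hε
  refine ⟨m, hm, fun i j => c i ⁻¹' {j}, ?_, ?_, ?_⟩
  · exact fun i j j' hj => (Set.disjoint_singleton.2 hj).preimage (c i)
  · exact fun i => Set.iUnion_eq_univ_iff.2 fun s => ⟨c i s, rfl⟩
  · intro j x y hx hy k
    exact (dist_le_pi_dist (f x) (f y) k).trans_lt
      (hc x y fun i => (hx i).trans (hy i).symm)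
end

section
/- Let A = (a_{ij})_{1≤i≤n, 1≤j≤m} (with n, m ≥ 1) be a matrix over a set X without forbidden rectangles. Then there exist y_1, …, y_n ∈ X and z_1, …, z_m ∈ X such that for all i ∈ {1,…,n} and j ∈ {1,…,m}, a_{ij} = y_i or a_{ij} = z_j. -/
/-- A forbidden rectangle in a matrix. -/
def HasForbiddenRect {X : Type*} {n m : ℕ} (a : Fin n → Fin m → X) : Prop :=
  ∃ (i i' : Fin n) (j j' : Fin m), i ≠ i' ∧ j ≠ j' ∧
    a i j ≠ a i' j ∧ a i' j ≠ a i' j' ∧ a i' j' ≠ a i j' ∧ a i j' ≠ a i j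

/-- Row `i` is constant on the set of columns where it differs from row `k`. -/
def ConstOnDiff {X ι κ : Type*} (a : ι → κ → X) (i k : ι) : Prop :=
  ∀ j j', a i j ≠ a k j → a i j' ≠ a k j' → a i j = a i j'

/-- Some row is not constant on the set of columns where it differs from row `i`. -/
def IsForced {X ι κ : Type*} (a : ι → κ → X) (i : ι) : Prop :=
  ∃ g, ¬ ConstOnDiff a g i

/-- In each column where rows `i` and `k` differ, one of them equals its label under `y`. -/
def Compatible {X ι κ : Type*} (a : ι → κ → X) (y : ι → X) (i k : ι) : Prop :=
  ∀ j, a i j = a k j ∨ a i j = y i ∨ a k j = y k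

/-- The value `p i` is taken by a forced row `i` wherever it differs from a row forcing it. -/
def IsForcing {X ι κ : Type*} (a : ι → κ → X) (p : ι → X) : Prop :=
  ∀ i g, ¬ ConstOnDiff a g i → ∀ j, a i j ≠ a g j → a i j = p i

/-- The forced rows, labelled by `p`, impose the label `v` on row `k`. -/
def Propagates {X ι κ : Type*} (a : ι → κ → X) (p : ι → X) (k : ι) (v : X) : Prop :=
  ∃ f, IsForced a f ∧ ∃ j, a f j ≠ a k j ∧ a f j ≠ p f ∧ a k j = v

theorem constOnDiff_or {X : Type*} {n m : ℕ} {a : Fin n → Fin m → X}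
    (h : ¬ HasForbiddenRect a) (i k : Fin n) : ConstOnDiff a i k ∨ ConstOnDiff a k i := by
  have key : ∀ j j', a i j ≠ a k j → a i j' ≠ a k j' → a i j = a i j' ∨ a k j = a k j' := by
    intro j j' h1 h2
    by_contra! hc
    refine h ⟨i, k, j, j', ?_, ?_, h1, hc.2, h2.symm, hc.1.symm⟩
    · rintro rfl
      exact h1 rfl
    · rintro rfl
      exact hc.1 rfl
  by_contra! hc
  simp only [ConstOnDiff, not_forall] at hc
  obtain ⟨⟨j1, j2, h1, h2, h3⟩, j3, j4, h4, h5, h6⟩ := hc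
  have k12 := key j1 j2 h1 h2
  have k34 := key j3 j4 h4.symm h5.symm
  have k13 := key j1 j3 h1 h4.symm
  have k14 := key j1 j4 h1 h5.symm
  have k23 := key j2 j3 h2 h4.symm
  have k24 := key j2 j4 h2 h5.symm
  grind

section Rows

variable {X ι κ : Type*} {a : ι → κ → X}

theorem exists_isForcing [Nonempty X] (tot : ∀ i k, ConstOnDiff a i k ∨ ConstOnDiff a k i) :
    ∃ p, IsForcing a p := by
  have key : ∀ i, ∃ v, ∀ g, ¬ ConstOnDiff a g i → ∀ j, a i j ≠ a g j → a i j = v := by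
    intro i
    by_cases hi : ∃ g, ¬ ConstOnDiff a g i
    · obtain ⟨g, hg⟩ := hi
      have hg' := hg
      simp only [ConstOnDiff, not_forall] at hg'
      obtain ⟨e1, e2, h1, h2, h3⟩ := hg'
      refine ⟨a i e1, fun g' hg' j hj => ?_⟩
      have c1 : ConstOnDiff a i g := (tot i g).resolve_right hg
      have c2 : ConstOnDiff a i g' := (tot i g').resolve_right hg'
      simp only [ConstOnDiff, not_forall] at hg'
      obtain ⟨d1, d2, h4, h5, h6⟩ := hg'
      have t := tot g g'
      simp only [ConstOnDiff] at c1 c2 t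
      have := c1 e1 e2 h1.symm h2.symm
      have := c2 d1 d2 h4.symm h5.symm
      have := c2 j d1 hj h4.symm
      by_contra hne
      have := c1 d1 e1
      have := c1 d2 e1
      have := c2 e1 d1
      have := c2 e2 d1
      rcases t with t | t
      · have := t e1 e2
        grind
      · have := t d1 d2
        grind
    · exact ⟨Classical.arbitrary X, fun g hg => (hi ⟨g, hg⟩).elim⟩
  choose p hp using key
  exact ⟨p, hp⟩

theorem compatible_of_isForced {p : ι → X} (hp : IsForcing a p) {f f' : ι} (hf : IsForced a f) :
    Compatible a p f f' := by
  by_contra hc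
  simp only [Compatible, not_forall, not_or] at hc
  obtain ⟨j, h1, h2, h3⟩ := hc
  have c2 : ConstOnDiff a f f' := by
    by_contra h
    exact h3 (hp f' f h j (Ne.symm h1))
  obtain ⟨g, hg⟩ := hf
  have q := hp f g hg
  simp only [ConstOnDiff, not_forall] at hg
  obtain ⟨e1, e2, h4, h5, h6⟩ := hg
  have := c2 e1 j
  have := c2 e2 j
  have q1 := q e1
  have q2 := q e2
  have q3 := q j
  have hgf : ¬ ConstOnDiff a g f' := by
    intro h
    have := h e1 e2
    grind
  have := hp f' g hgf j
  grind

theorem propagates_unique {p : ι → X} (hp : IsForcing a p) {k : ι} (hk : ¬ IsForced a k) {u v : X}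
    (hu : Propagates a p k u) (hv : Propagates a p k v) : u = v := by
  obtain ⟨f, hf, j, h1, h2, rfl⟩ := hu
  obtain ⟨f', hf', j', h1', h2', rfl⟩ := hv
  have c : ∀ g, ConstOnDiff a g k := by simpa [IsForced] using hk
  by_contra hne
  have c1 : ConstOnDiff a k f := by
    by_contra h
    exact h2 (hp f k h j h1)
  have c2 : ConstOnDiff a k f' := by
    by_contra h
    exact h2' (hp f' k h j' h1')
  have e1 : a f j' = a k j' := by
    by_contra h
    exact hne (c1 j j' h1.symm (Ne.symm h))
  have e2 : a f' j = a k j := by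
    by_contra h
    exact hne (c2 j j' (Ne.symm h) h1'.symm)
  have c3 : ConstOnDiff a f f' := by
    by_contra h
    exact h2' (hp f' f h j' (by grind))
  have e3 : a f j = a f j' := c3 j j' (by grind) (by grind)
  obtain ⟨g, hg⟩ := hf
  have q := hp f g hg
  simp only [ConstOnDiff, not_forall] at hg
  obtain ⟨d1, d2, h4, h5, h6⟩ := hg
  have q1 := q d1
  have q2 := q d2
  have q3 := q j
  have := c f d1 j
  have := c f d2 j
  have := c g d1 d2
  grind

theorem propagates_of_ne {p : ι → X} (hp : IsForcing a p) {k l : ι} (hl : ¬ IsForced a l)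
    {u : X} (hu : Propagates a p k u) {j : κ} (hj : a k j ≠ a l j) (hne : a k j ≠ u) :
    Propagates a p l (a l j) := by
  obtain ⟨f, hf, j0, h1, h2, rfl⟩ := hu
  have c : ∀ g, ConstOnDiff a g l := by simpa [IsForced] using hl
  have c1 : ConstOnDiff a k f := by
    by_contra h
    exact h2 (hp f k h j0 h1)
  have e : a f j = a k j := by
    by_contra h
    exact hne (c1 j j0 (Ne.symm h) h1.symm)
  refine ⟨f, hf, j, e ▸ hj, fun h => ?_, rfl⟩
  have := c k j0 j
  have := c f j0 j
  grind

theorem exists_compatible_of_constOnDiff [Nonempty X] (S : Finset ι)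
    (hS : ∀ i ∈ S, ∀ k ∈ S, ConstOnDiff a i k) :
    ∃ y : ι → X, ∀ i ∈ S, ∀ k ∈ S, Compatible a y i k := by
  classical
  induction S using Finset.strongInduction with
  | H S ih =>
  rcases S.eq_empty_or_nonempty with rfl | ⟨i, hi⟩
  · exact ⟨fun _ => Classical.arbitrary X, by simp⟩
  let p : X := Classical.arbitrary X
  let K : ι → Prop := fun k => ∃ j, a i j ≠ a k j ∧ a i j ≠ p
  have hsub : S.filter (fun k => k ≠ i ∧ ¬ K k) ⊂ S := by
    refine Finset.filter_ssubset.2 ⟨i, hi, by simp⟩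
  obtain ⟨y, hy⟩ := ih _ hsub fun k hk l hl =>
    hS k (Finset.mem_of_mem_filter k hk) l (Finset.mem_of_mem_filter l hl)
  have hv : ∀ k, ∃ v, k ∈ S → ∀ j, K k → a i j ≠ a k j → a k j = v := by
    intro k
    by_cases hk : K k
    · obtain ⟨j, hj, -⟩ := hk
      exact ⟨a k j, fun hkS j' _ hj' => hS k hkS i hi j' j hj'.symm hj.symm⟩
    · exact ⟨p, fun _ _ h => (hk h).elim⟩
  choose v hv using hv
  refine ⟨fun k => if k = i then p else if K k then v k else y k, fun k hk l hl j => ?_⟩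
  have hKi : ¬ K i := by simp [K]
  have hp : ∀ l, ¬ K l → a i j ≠ a l j → a i j = p := by
    intro l hl hj
    by_contra h
    exact hl ⟨j, hj, h⟩
  have hkey : ∀ k ∈ S, ∀ l ∈ S, K k → ¬ K l → a k j = a l j ∨ a k j = v k := by
    intro k hk l hl hKk hKl
    by_contra! hc
    have h1 : a i j = a k j := by
      by_contra h
      exact hc.2 (hv k hk j hKk h)
    obtain ⟨j0, h2, h3⟩ := id hKk
    have h4 : a i j0 = a l j0 := by
      by_contra h
      exact hKl ⟨j0, h, h3⟩
    have h5 := hS k hk l hl j0 j (by grind) hc.1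
    exact hc.2 (h5 ▸ hv k hk j0 hKk h2)
  have hpk := hp k
  have hpl := hp l
  have hkl := hkey k hk l hl
  have hlk := hkey l hl k hk
  have hvk := hv k hk j
  have hvl := hv l hl j
  have hyy : k ≠ i → ¬ K k → l ≠ i → ¬ K l → a k j = a l j ∨ a k j = y k ∨ a l j = y l :=
    fun h1 h2 h3 h4 => hy k (by simp [hk, h1, h2]) l (by simp [hl, h3, h4]) j
  clear hkey hp hy hv hsub ih hS
  clear_value K p
  by_cases h1 : k = i
  · subst h1
    by_cases h2 : l = k
    · exact Or.inl (h2 ▸ rfl)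
    · by_cases h3 : K l <;> simp only [h2, h3, if_true, if_false] <;> grind
  by_cases h2 : l = i
  · subst h2
    by_cases h3 : K k <;> simp only [h1, h3, if_true, if_false] <;> grind
  by_cases h3 : K k <;> by_cases h4 : K l <;> simp only [h1, h2, h3, h4, if_true, if_false] <;>
    grind

theorem exists_compatible [Nonempty X] [Fintype ι]
    (tot : ∀ i k, ConstOnDiff a i k ∨ ConstOnDiff a k i) :
    ∃ y : ι → X, ∀ i k, Compatible a y i k := by
  classical
  obtain ⟨p, hp⟩ := exists_isForcing tot
  obtain ⟨y, hy⟩ := exists_compatible_of_constOnDiff (a := a)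
    (Finset.univ.filter fun i => ¬ IsForced a i) (by
      intro i _ k hk
      by_contra h
      exact (Finset.mem_filter.1 hk).2 ⟨i, h⟩)
  have hw : ∀ k, ∃ w, (¬ IsForced a k → ∀ v, Propagates a p k v → v = w) ∧
      ((∀ v, ¬ Propagates a p k v) → w = y k) := by
    intro k
    by_cases h : ∃ v, Propagates a p k v
    · obtain ⟨v, hv⟩ := h
      exact ⟨v, fun hk u hu => propagates_unique hp hk hu hv, fun h => (h v hv).elim⟩
    · push Not at h
      exact ⟨y k, fun _ v hv => (h v hv).elim, fun _ => rfl⟩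
  choose w hw hwy using hw
  refine ⟨fun k => if IsForced a k then p k else w k, fun k l j => ?_⟩
  have mixed : ∀ k l, IsForced a k → ¬ IsForced a l →
      a k j = a l j ∨ a k j = p k ∨ a l j = w l := by
    intro k l hk hl
    by_contra! hc
    exact hc.2.2 (hw l hl _ ⟨k, hk, j, hc.1, hc.2.1, rfl⟩)
  have prop : ∀ k l, ¬ IsForced a k → ¬ IsForced a l → (∃ u, Propagates a p k u) →
      a k j = a l j ∨ a k j = w k ∨ a l j = w l := by
    rintro k l hk hl ⟨u, hu⟩
    by_contra! hc
    have := hw k hk u hu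
    exact hc.2.2 (hw l hl _ (propagates_of_ne hp hl hu hc.1 (this ▸ hc.2.1)))
  by_cases hk : IsForced a k <;> by_cases hl : IsForced a l <;> simp only [hk, hl, if_true, if_false]
  · exact compatible_of_isForced hp hk j
  · exact mixed k l hk hl
  · have := mixed l k hl hk
    grind
  · by_cases h1 : ∃ u, Propagates a p k u
    · exact prop k l hk hl h1
    by_cases h2 : ∃ u, Propagates a p l u
    · have := prop l k hl hk h2
      grind
    rw [hwy k (not_exists.1 h1), hwy l (not_exists.1 h2)]
    exact hy k (by simp [hk]) l (by simp [hl]) j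

end Rows

theorem statement10 {X : Type*} {n m : ℕ} (hn : 0 < n) (hm : 0 < m)
    (a : Fin n → Fin m → X) (hfr : ¬ HasForbiddenRect a) :
    ∃ (y : Fin n → X) (z : Fin m → X), ∀ i j, a i j = y i ∨ a i j = z j := by
  have : Nonempty X := ⟨a ⟨0, hn⟩ ⟨0, hm⟩⟩
  obtain ⟨y, hy⟩ := exists_compatible (constOnDiff_or hfr)
  have hz : ∀ j, ∃ v, ∀ i, a i j = y i ∨ a i j = v := by
    intro j
    by_cases h : ∃ i, a i j ≠ y i
    · obtain ⟨k, hk⟩ := h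
      refine ⟨a k j, fun i => ?_⟩
      have := hy i k j
      tauto
    · push Not at h
      exact ⟨y ⟨0, hn⟩, fun i => Or.inl (h i)⟩
  choose z hz using hz
  exact ⟨y, z, fun i j => hz j i⟩
end

section
/- An n×m matrix (n, m ≥ 1) over a set X without forbidden rectangles takes at most n + m distinct values: the cardinality of {a_{ij} : 1 ≤ i ≤ n, 1 ≤ j ≤ m} is at most n + m. -/
open SimpleGraph

/-- An acyclic graph on a nonempty finite vertex type has fewer edges than vertices. -/
lemma SimpleGraph.IsAcyclic.ncard_edgeSet_lt {V : Type*} [Fintype V] [Nonempty V]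
    {G : SimpleGraph V} (h : G.IsAcyclic) : G.edgeSet.ncard < Fintype.card V := by
  classical
  obtain ⟨F, hGF, hF⟩ := exists_maximal_isAcyclic_of_le_isAcyclic (le_top : G ≤ ⊤) h
  have hT : F.IsTree := (connected_top.maximal_le_isAcyclic_iff_isTree le_top).1 hF
  have hle : G.edgeSet.ncard ≤ F.edgeSet.ncard :=
    Set.ncard_le_ncard (edgeSet_mono hGF) (Set.toFinite _)
  have hcard := hT.card_edgeFinset
  rw [← coe_edgeFinset F, Set.ncard_coe_finset] at hle
  omega

lemma adj_completeBipartiteGraph_of_adj_of_adj_of_adj {R C : Type*} {v₀ v₁ v₂ v₃ : R ⊕ C}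
    (h₁ : (completeBipartiteGraph R C).Adj v₀ v₁) (h₂ : (completeBipartiteGraph R C).Adj v₁ v₂)
    (h₃ : (completeBipartiteGraph R C).Adj v₂ v₃) : (completeBipartiteGraph R C).Adj v₀ v₃ := by
  cases v₀ <;> cases v₁ <;> cases v₂ <;> cases v₃ <;> simp_all [completeBipartiteGraph]

/-- If a colouring of a complete bipartite graph has no 4-cycle with pairwise distinct colours,
then it has no nonempty closed walk with pairwise distinct colours. -/
lemma not_nodup_map_edges {X R C : Type*} (col : Sym2 (R ⊕ C) → X)
    (hcol : ∀ v₀ v₁ v₂ v₃, (completeBipartiteGraph R C).Adj v₀ v₁ →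
      (completeBipartiteGraph R C).Adj v₁ v₂ → (completeBipartiteGraph R C).Adj v₂ v₃ →
      (completeBipartiteGraph R C).Adj v₃ v₀ →
      ¬ [col s(v₀, v₁), col s(v₁, v₂), col s(v₂, v₃), col s(v₀, v₃)].Nodup)
    {v : R ⊕ C} (w : (completeBipartiteGraph R C).Walk v v) (hw : 0 < w.length) :
    ¬ (w.edges.map col).Nodup := by
  induction hn : w.length using Nat.strong_induction_on generalizing w with
  | _ n ih =>
    intro hnd
    match w with
    | .nil => simp at hw
    | .cons h₁ .nil => exact h₁.ne rfl
    | .cons (v := v₁) h₁ (.cons h₂ .nil) =>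
      simp [Sym2.eq_swap (a := v) (b := v₁)] at hnd
    | .cons (v := v₁) h₁ (.cons (v := v₂) h₂ (.cons (v := v₃) h₃ w')) =>
      have h₀ : (completeBipartiteGraph R C).Adj v v₃ := adj_completeBipartiteGraph_of_adj_of_adj_of_adj h₁ h₂ h₃
      have hshort := ih (Walk.cons h₀ w').length (by simp [← hn]) (Walk.cons h₀ w')
        (by simp) rfl
      have hrect := hcol v v₁ v₂ v₃ h₁ h₂ h₃ h₀.symm
      simp only [Walk.edges_cons, List.map_cons, List.nodup_cons, List.mem_cons, not_or,
        List.not_mem_nil, not_false_eq_true, List.nodup_nil, and_true] at hnd hshort hrect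
      grind

/-- The colouring of pairs of vertices of a complete bipartite graph given by a matrix, with a
default value on pairs lying on the same side. -/
def matrixColor {X R C : Type*} (a : R → C → X) (x : X) : Sym2 (R ⊕ C) → X :=
  Sym2.lift ⟨fun
    | .inl i, .inr j => a i j
    | .inr j, .inl i => a i j
    | _, _ => x, by rintro (i | j) (i' | j') <;> rfl⟩

@[simp]
lemma matrixColor_inl_inr {X R C : Type*} (a : R → C → X) (x : X) (i : R) (j : C) :
    matrixColor a x s(.inl i, .inr j) = a i j := rfl

@[simp]
lemma matrixColor_inr_inl {X R C : Type*} (a : R → C → X) (x : X) (i : R) (j : C) :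
    matrixColor a x s(.inr j, .inl i) = a i j := rfl

lemma not_nodup_matrixColor {X : Type*} {n m : ℕ} {a : Fin n → Fin m → X}
    (hfr : ¬ HasForbiddenRect a) (x : X) (v₀ v₁ v₂ v₃ : Fin n ⊕ Fin m)
    (h₁ : (completeBipartiteGraph _ _).Adj v₀ v₁) (h₂ : (completeBipartiteGraph _ _).Adj v₁ v₂)
    (h₃ : (completeBipartiteGraph _ _).Adj v₂ v₃) (h₄ : (completeBipartiteGraph _ _).Adj v₃ v₀) :
    ¬ [matrixColor a x s(v₀, v₁), matrixColor a x s(v₁, v₂), matrixColor a x s(v₂, v₃),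
      matrixColor a x s(v₀, v₃)].Nodup := by
  intro h
  rcases v₀ with i | j <;> rcases v₁ with i' | j' <;> simp [completeBipartiteGraph] at h₁ <;>
    rcases v₂ with k | l <;> simp [completeBipartiteGraph] at h₂ <;>
    rcases v₃ with k' | l' <;> simp [completeBipartiteGraph] at h₃
  · simp at h
    exact hfr ⟨i, k, j', l', by grind, by grind, by grind, by grind, by grind, by grind⟩
  · simp at h
    exact hfr ⟨i', k', j, l, by grind, by grind, by grind, by grind, by grind, by grind⟩

theorem statement11 {X : Type*} {n m : ℕ} (hn : 0 < n) (hm : 0 < m)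
    (a : Fin n → Fin m → X) (hfr : ¬ HasForbiddenRect a) :
    Set.ncard {u : X | ∃ i j, a i j = u} ≤ n + m := by
  have : Nonempty (Fin n ⊕ Fin m) := ⟨.inl ⟨0, hn⟩⟩
  set S : Set X := {u : X | ∃ i j, a i j = u}
  let col := matrixColor a (a ⟨0, hn⟩ ⟨0, hm⟩)
  choose r c hrc using fun u : S ↦ u.2
  let e : S → Sym2 (Fin n ⊕ Fin m) := fun u ↦ s(.inl (r u), .inr (c u))
  have hcol (u : S) : col (e u) = u := hrc u
  let G : SimpleGraph (Fin n ⊕ Fin m) := fromEdgeSet (Set.range e)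
  have hedge : G.edgeSet = Set.range e := by
    rw [edgeSet_fromEdgeSet, sdiff_eq_left, Set.disjoint_left]
    rintro _ ⟨u, rfl⟩
    simp [e]
  have hcard : G.edgeSet.ncard = S.ncard := by
    rw [hedge, ← Set.image_univ, Set.ncard_image_of_injective, Set.ncard_univ,
      Nat.card_coe_set_eq]
    intro u v huv
    exact Subtype.ext (by rw [← hcol u, huv, hcol v])
  have hle : G ≤ completeBipartiteGraph (Fin n) (Fin m) := by
    rw [← edgeSet_subset_edgeSet, hedge]
    rintro _ ⟨u, rfl⟩
    simp [e, completeBipartiteGraph]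
  have hacyc : G.IsAcyclic := by
    intro v p hp
    refine not_nodup_map_edges col (not_nodup_matrixColor hfr _) (p.mapLe hle) ?_ ?_
    · rw [Walk.length_mapLe]
      have := hp.three_le_length
      omega
    · rw [Walk.edges_mapLe_eq_edges]
      refine hp.edges_nodup.map_on fun x hx y hy hxy ↦ ?_
      obtain ⟨u, rfl⟩ := hedge ▸ p.edges_subset_edgeSet hx
      obtain ⟨u', rfl⟩ := hedge ▸ p.edges_subset_edgeSet hy
      rw [hcol, hcol] at hxy
      rw [Subtype.ext hxy]
  have := hacyc.ncard_edgeSet_lt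
  rw [hcard, Fintype.card_sum, Fintype.card_fin, Fintype.card_fin] at this
  exact this.le
end

section
/- Every finite nonempty matrix A = (a_{ij})_{1≤i≤n, 1≤j≤m} over a set X without forbidden rectangles is stripe-decomposable or corner-decomposable. Here A is stripe-decomposable if some row of A is constant or some column of A is constant; and A is corner-decomposable if there exist three distinct row indices i_1, i_2, i_3, three distinct column indices j_1, j_2, j_3, and pairwise distinct values x, y, z ∈ X such that a_{i_1 j_1} = x, a_{i_1 j_2} = x, a_{i_1 j_3} = z, a_{i_2 j_1} = x, a_{i_2 j_2} = y, a_{i_2 j_3} = y, a_{i_3 j_1} = z, a_{i_3 j_2} = y, a_{i_3 j_3} = z, and moreover for every column index j ∉ {j_1, j_2, j_3}: a_{i_1 j} ∈ {x, z}, a_{i_2 j} ∈ {x, y}, a_{i_3 j} ∈ {y, z}, and for every row index i ∉ {i_1, i_2, i_3}: a_{i j_1} ∈ {x, z}, a_{i j_2} ∈ {x, y}, a_{i j_3} ∈ {y, z}. -/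
/-- Every rectangle of `a` has two adjacent equal corners. -/
def RectFree {I J X : Type*} (a : I → J → X) : Prop :=
  ∀ i i' j j', a i j = a i' j ∨ a i' j = a i' j' ∨ a i' j' = a i j' ∨ a i j' = a i j

/-- Some row indexed by `R` takes only the values `x` and `y` on the columns in `C`. -/
def HasPairRow {I J X : Type*} (a : I → J → X) (R : Finset I) (C : Finset J) (x y : X) : Prop :=
  ∃ i ∈ R, ∀ j ∈ C, a i j = x ∨ a i j = y

/-- Each of the pairs `{x, z}`, `{x, y}`, `{y, z}` contains all the values of some row. -/
def HasPairRows {I J X : Type*} (a : I → J → X) (R : Finset I) (C : Finset J) (x y z : X) : Prop :=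
  HasPairRow a R C x z ∧ HasPairRow a R C x y ∧ HasPairRow a R C y z

/-- There are three values each pair of which contains all the values of some row and all the
values of some column. -/
def HasCorner {I J X : Type*} (a : I → J → X) (R : Finset I) (C : Finset J) : Prop :=
  ∃ x y z, x ≠ y ∧ x ≠ z ∧ y ≠ z ∧ HasPairRows a R C x y z ∧
    HasPairRows (fun j i => a i j) C R x y z

/-- Some row indexed by `R` is constant on `C`. -/
def HasConstRow {I J X : Type*} (a : I → J → X) (R : Finset I) (C : Finset J) : Prop :=
  ∃ i ∈ R, ∃ v, ∀ j ∈ C, a i j = v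

section

variable {I J X : Type*} {a : I → J → X} {R : Finset I} {C : Finset J}

theorem RectFree.transpose (h : RectFree a) : RectFree fun j i => a i j := by
  intro j j' i i'
  have := h i i' j j'
  grind

theorem HasCorner.transpose (h : HasCorner a R C) : HasCorner (fun j i => a i j) C R := by
  obtain ⟨x, y, z, hxy, hxz, hyz, hr, hc⟩ := h
  exact ⟨x, y, z, hxy, hxz, hyz, hc, hr⟩

theorem HasPairRow.swap {x y : X} (h : HasPairRow a R C x y) : HasPairRow a R C y x := by
  obtain ⟨i, hi, h⟩ := h
  exact ⟨i, hi, fun j hj => (h j hj).symm⟩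

theorem HasPairRow.mono [DecidableEq I] {x y : X} (h : HasPairRow a R C x y) (p : I) :
    HasPairRow a (insert p R) C x y := by
  obtain ⟨i, hi, h⟩ := h
  exact ⟨i, Finset.mem_insert_of_mem hi, h⟩

theorem HasPairRows.mono [DecidableEq I] {x y z : X} (h : HasPairRows a R C x y z) (p : I) :
    HasPairRows a (insert p R) C x y z :=
  ⟨h.1.mono p, h.2.1.mono p, h.2.2.mono p⟩

/-- A column with values in `{x, z}` survives the addition of a row, is replaced by another such
column, or the new row is constant. -/
theorem RectFree.extend_pairCol [DecidableEq I] (h : RectFree a) {x y z : X}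
    (hxy : x ≠ y) (hxz : x ≠ z) (hyz : y ≠ z) (hr : HasPairRows a R C x y z)
    (hc : HasPairRows (fun j i => a i j) C R x y z) (p : I) :
    HasPairRow (fun j i => a i j) C (insert p R) x z ∨ ∃ v, ∀ j ∈ C, a p j = v := by
  obtain ⟨⟨i₁, hi₁, hr₁⟩, ⟨i₂, hi₂, hr₂⟩, ⟨i₃, hi₃, hr₃⟩⟩ := hr
  obtain ⟨⟨j₁, hj₁, hc₁⟩, ⟨j₂, hj₂, hc₂⟩, ⟨j₃, hj₃, hc₃⟩⟩ := hc
  dsimp only at hc₁ hc₂ hc₃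
  by_cases hp : a p j₁ = x ∨ a p j₁ = z
  · left
    refine ⟨j₁, hj₁, fun i hi => ?_⟩
    rcases Finset.mem_insert.1 hi with rfl | hi
    exacts [hp, hc₁ i hi]
  push Not at hp
  have e₁₂ : a i₁ j₂ = x := by grind
  have e₁₃ : a i₁ j₃ = z := by grind
  have e₂₁ : a i₂ j₁ = x := by grind
  have e₂₃ : a i₂ j₃ = y := by grind
  have e₃₁ : a i₃ j₁ = z := by grind
  have e₃₂ : a i₃ j₂ = y := by grind
  have d₁ := hr₁ j₁ hj₁
  have d₂ := hr₂ j₂ hj₂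
  have d₃ := hr₃ j₃ hj₃
  have d₁₂ := h i₁ i₂ j₁ j₂
  have d₁₃ := h i₁ i₃ j₁ j₃
  have d₂₃ := h i₂ i₃ j₂ j₃
  have hw : a p j₂ = a p j₁ ∧ a p j₃ = a p j₁ := by
    have := h p i₁ j₁ j₂
    have := h p i₁ j₁ j₃
    have := h p i₂ j₁ j₂
    have := h p i₂ j₁ j₃
    have := h p i₃ j₁ j₂
    have := h p i₃ j₁ j₃
    have := h p i₁ j₂ j₃
    have := h p i₂ j₂ j₃
    have := h p i₃ j₂ j₃
    grind
  by_cases hconst : ∀ j ∈ C, a p j = a p j₁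
  · exact Or.inr ⟨_, hconst⟩
  push Not at hconst
  obtain ⟨j, hj, hjp⟩ := hconst
  left
  have f₁ := hr₁ j hj
  have f₂ := hr₂ j hj
  have f₃ := hr₃ j hj
  have hy : a p j₁ = y ∧ (a p j = x ∨ a p j = z) := by
    have := h p i₁ j₁ j
    have := h p i₁ j₂ j
    have := h p i₁ j₃ j
    have := h p i₂ j₁ j
    have := h p i₂ j₂ j
    have := h p i₂ j₃ j
    have := h p i₃ j₁ j
    have := h p i₃ j₂ j
    have := h p i₃ j₃ j
    grind
  refine ⟨j, hj, fun i hi => ?_⟩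
  rcases Finset.mem_insert.1 hi with rfl | hi
  · exact hy.2
  · have := hc₁ i hi
    have := h p i j₁ j
    grind

theorem RectFree.extend_corner [DecidableEq I] (h : RectFree a) (hcor : HasCorner a R C) (p : I) :
    HasCorner a (insert p R) C ∨ ∃ v, ∀ j ∈ C, a p j = v := by
  obtain ⟨x, y, z, hxy, hxz, hyz, hr, hc⟩ := hcor
  by_cases hconst : ∃ v, ∀ j ∈ C, a p j = v
  · exact Or.inr hconst
  refine Or.inl ⟨x, y, z, hxy, hxz, hyz, hr.mono p,
    (h.extend_pairCol hxy hxz hyz hr hc p).resolve_right hconst,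
    (h.extend_pairCol hxz hxy hyz.symm ?_ ?_ p).resolve_right hconst,
    (h.extend_pairCol hxy.symm hyz hxz ?_ ?_ p).resolve_right hconst⟩
  · exact ⟨hr.2.1, hr.1, hr.2.2.swap⟩
  · exact ⟨hc.2.1, hc.1, hc.2.2.swap⟩
  · exact ⟨hr.2.2, hr.2.1.swap, hr.1⟩
  · exact ⟨hc.2.2, hc.2.1.swap, hc.1⟩

/-- If every column becomes non-constant because of at most one row, and no column is constant,
then three rows yield three columns with distinct generic values, and there is no fourth row. -/
theorem RectFree.exists_almostConst_cols [DecidableEq I] (h : RectFree a)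
    (hcol : ¬ HasConstRow (fun j i => a i j) C R)
    (hdel : ∀ p ∈ R, HasConstRow (fun j i => a i j) C (R.erase p)) (hR : 3 ≤ R.card) :
    R.card = 3 ∧ 3 ≤ C.card ∧ ∃ x y z, x ≠ y ∧ x ≠ z ∧ y ≠ z ∧
      HasPairRows (fun j i => a i j) C R x y z ∧
      (C.card = 3 → HasPairRows a R C x y z) := by
  classical
  have hne (p : I) (hp : p ∈ R) : ∃ j ∈ C, ∃ v, (∀ i ∈ R, i ≠ p → a i j = v) ∧ a p j ≠ v := by
    obtain ⟨j, hj, v, hv⟩ := hdel p hp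
    refine ⟨j, hj, v, fun i hi hip => hv i (Finset.mem_erase.2 ⟨hip, hi⟩), fun hpv => ?_⟩
    refine hcol ⟨j, hj, v, fun i hi => ?_⟩
    by_cases hip : i = p
    · exact hip ▸ hpv
    · exact hv i (Finset.mem_erase.2 ⟨hip, hi⟩)
  obtain ⟨p, hp, q, hq, s, hs, hpq, hps, hqs⟩ := Finset.two_lt_card.1 hR
  obtain ⟨j, -, v, -⟩ := hne p hp
  have : Nonempty J := ⟨j⟩
  have : Nonempty X := ⟨v⟩
  clear j v
  choose! f hfC v hv hw using hne
  have hvne : ∀ i ∈ R, ∀ k ∈ R, i ≠ k → v i ≠ v k := by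
    intro i hi k hk hik
    have := h i k (f i) (f k)
    grind
  have hpair : ∀ i ∈ R, ∀ k ∈ R, i ≠ k → a i (f i) = v k ∨ a k (f k) = v i := by
    intro i hi k hk hik
    have := h i k (f i) (f k)
    grind
  have hcard : R.card = 3 := by
    by_contra hcard
    obtain ⟨t, ht, ht'⟩ : ∃ t ∈ R, t ∉ ({p, q, s} : Finset I) :=
      Finset.exists_mem_notMem_of_card_lt_card (by
        have := Finset.card_le_three (a := p) (b := q) (c := s)
        omega)
    have := hpair p hp q hq hpq
    have := hpair p hp s hs hps
    have := hpair q hq s hs hqs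
    simp only [Finset.mem_insert, Finset.mem_singleton, not_or] at ht'
    have := hpair t ht p hp ht'.1
    have := hpair t ht q hq ht'.2.1
    have := hpair t ht s hs ht'.2.2
    have := hvne p hp q hq hpq
    have := hvne p hp s hs hps
    have := hvne q hq s hs hqs
    have := hvne t ht p hp ht'.1
    have := hvne t ht q hq ht'.2.1
    have := hvne t ht s hs ht'.2.2
    grind
  have hinj : Set.InjOn f (R : Set I) := by
    intro i hi k hk hik
    by_contra hne
    obtain ⟨l, hl, hl'⟩ : ∃ l ∈ R, l ∉ ({i, k} : Finset I) :=
      Finset.exists_mem_notMem_of_card_lt_card (by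
        have := Finset.card_le_two (a := i) (b := k)
        omega)
    grind
  have hCcard : 3 ≤ C.card := hR.trans (Finset.card_le_card_of_injOn f hfC hinj)
  refine ⟨hcard, hCcard, ?_⟩
  have himg : C.card = 3 → C = R.image f := fun hC =>
    (Finset.eq_of_subset_of_card_le (Finset.image_subset_iff.2 hfC)
      (by rw [Finset.card_image_of_injOn hinj]; omega)).symm
  have hR3 : R = {p, q, s} := (Finset.eq_of_subset_of_card_le (by grind)
    (by rw [Finset.card_eq_three.2 ⟨p, q, s, hpq, hps, hqs, rfl⟩]; omega)).symm
  wlog hw₁ : a p (f p) = v q ∧ a s (f s) = v p ∧ a q (f q) = v s generalizing p q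
  · refine this q hq p hp hpq.symm hqs hps (by rw [hR3, Finset.insert_comm]) ?_
    have := hpair p hp q hq hpq
    have := hpair p hp s hs hps
    have := hpair q hq s hs hqs
    have := hvne p hp q hq hpq
    have := hvne p hp s hs hps
    have := hvne q hq s hs hqs
    grind
  obtain ⟨hwp, hws, hwq⟩ := hw₁
  have hval (i : I) (hi : i ∈ R) (k : I) (hk : k ∈ R) :
      a i (f k) = v k ∨ i = k := by
    by_cases hik : i = k
    · exact Or.inr hik
    · exact Or.inl (hv k hk i hi hik)
  refine ⟨v p, v q, v s, hvne p hp q hq hpq, hvne p hp s hs hps, hvne q hq s hs hqs,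
    ⟨⟨f s, hfC s hs, ?_⟩, ⟨f p, hfC p hp, ?_⟩, ⟨f q, hfC q hq, ?_⟩⟩, fun hC =>
    ⟨⟨q, hq, ?_⟩, ⟨s, hs, ?_⟩, ⟨p, hp, ?_⟩⟩⟩
  · intro i hi
    rcases hval i hi s hs with h | rfl <;> grind
  · intro i hi
    rcases hval i hi p hp with h | rfl <;> grind
  · intro i hi
    rcases hval i hi q hq with h | rfl <;> grind
  all_goals
    rw [himg hC]
    refine Finset.forall_mem_image.2 fun k hk => ?_
    have hk' := hk
    rw [hR3, Finset.mem_insert, Finset.mem_insert, Finset.mem_singleton] at hk'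
  · have := hval q hq k hk
    grind
  · have := hval s hs k hk
    grind
  · have := hval p hp k hk
    grind

theorem RectFree.const_or_corner [DecidableEq I] [DecidableEq J] (h : RectFree a) (k : ℕ) :
    ∀ (R : Finset I) (C : Finset J), R.card + C.card = k → R.Nonempty → C.Nonempty →
      HasConstRow a R C ∨ HasConstRow (fun j i => a i j) C R ∨ HasCorner a R C := by
  induction k with
  | zero =>
    intro R C hRC hR
    have := hR.card_pos
    omega
  | succ k ih =>
    intro R C hRC hR hC
    by_contra! hcon
    obtain ⟨hrow, hcol, hcor⟩ := hcon
    have hR2 : 2 ≤ R.card := by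
      by_contra hlt
      obtain ⟨i, rfl⟩ := Finset.card_eq_one.1 (show R.card = 1 by have := hR.card_pos; omega)
      obtain ⟨j, hj⟩ := hC
      exact hcol ⟨j, hj, a i j, by simp⟩
    have hC2 : 2 ≤ C.card := by
      by_contra hlt
      obtain ⟨j, rfl⟩ := Finset.card_eq_one.1 (show C.card = 1 by have := hC.card_pos; omega)
      obtain ⟨i, hi⟩ := hR
      exact hrow ⟨i, hi, a i j, by simp⟩
    have hRdel : ∀ p ∈ R, HasConstRow (fun j i => a i j) C (R.erase p) := by
      intro p hp
      have hcard := Finset.card_erase_of_mem hp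
      rcases ih (R.erase p) C (by omega) (Finset.card_pos.1 (by omega)) hC with h' | h' | h'
      · obtain ⟨i, hi, hv⟩ := h'
        exact (hrow ⟨i, Finset.mem_of_mem_erase hi, hv⟩).elim
      · exact h'
      · rcases h.extend_corner h' p with h' | h'
        · exact (hcor (Finset.insert_erase hp ▸ h')).elim
        · exact (hrow ⟨p, hp, h'⟩).elim
    have hCdel : ∀ q ∈ C, HasConstRow a R (C.erase q) := by
      intro q hq
      have hcard := Finset.card_erase_of_mem hq
      rcases ih R (C.erase q) (by omega) hR (Finset.card_pos.1 (by omega)) with h' | h' | h'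
      · exact h'
      · obtain ⟨j, hj, hv⟩ := h'
        exact (hcol ⟨j, Finset.mem_of_mem_erase hj, hv⟩).elim
      · rcases h.transpose.extend_corner h'.transpose q with h' | h'
        · exact (hcor (Finset.insert_erase hq ▸ h').transpose).elim
        · exact (hcol ⟨q, hq, h'⟩).elim
    by_cases hC3 : 3 ≤ C.card
    · obtain ⟨hC3, hR3, -⟩ := h.transpose.exists_almostConst_cols hrow hCdel hC3
      obtain ⟨-, -, x, y, z, hxy, hxz, hyz, hc, hr⟩ := h.exists_almostConst_cols hcol hRdel hR3
      exact hcor ⟨x, y, z, hxy, hxz, hyz, hr hC3, hc⟩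
    by_cases hR3 : 3 ≤ R.card
    · exact hC3 (h.exists_almostConst_cols hcol hRdel hR3).2.1
    obtain ⟨i, k, -, rfl⟩ := Finset.card_eq_two.1 (show R.card = 2 by omega)
    obtain ⟨j, l, -, rfl⟩ := Finset.card_eq_two.1 (show C.card = 2 by omega)
    rcases h i k j l with e | e | e | e
    · exact hcol ⟨j, by simp, a i j, by simp [e]⟩
    · exact hrow ⟨k, by simp, a k j, by simp [e]⟩
    · exact hcol ⟨l, by simp, a i l, by simp [e]⟩
    · exact hrow ⟨i, by simp, a i j, by simp [e]⟩

end

theorem statement12 {X : Type*} {n m : ℕ} (hn : 0 < n) (hm : 0 < m)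
    (a : Fin n → Fin m → X) (hfr : ¬ HasForbiddenRect a) :
    -- stripe-decomposable
    ((∃ i, ∀ j j', a i j = a i j') ∨ (∃ j, ∀ i i', a i j = a i' j)) ∨
    -- corner-decomposable
    (∃ (i1 i2 i3 : Fin n) (j1 j2 j3 : Fin m) (x y z : X),
      i1 ≠ i2 ∧ i1 ≠ i3 ∧ i2 ≠ i3 ∧ j1 ≠ j2 ∧ j1 ≠ j3 ∧ j2 ≠ j3 ∧
      x ≠ y ∧ x ≠ z ∧ y ≠ z ∧
      a i1 j1 = x ∧ a i1 j2 = x ∧ a i1 j3 = z ∧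
      a i2 j1 = x ∧ a i2 j2 = y ∧ a i2 j3 = y ∧
      a i3 j1 = z ∧ a i3 j2 = y ∧ a i3 j3 = z ∧
      (∀ j, j ≠ j1 → j ≠ j2 → j ≠ j3 →
        (a i1 j = x ∨ a i1 j = z) ∧ (a i2 j = x ∨ a i2 j = y) ∧
        (a i3 j = y ∨ a i3 j = z)) ∧
      (∀ i, i ≠ i1 → i ≠ i2 → i ≠ i3 →
        (a i j1 = x ∨ a i j1 = z) ∧ (a i j2 = x ∨ a i j2 = y) ∧
        (a i j3 = y ∨ a i j3 = z))) := by
  have h : RectFree a := by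
    intro i i' j j'
    by_contra! hne
    refine hfr ⟨i, i', j, j', ?_, ?_, hne.1, hne.2.1, hne.2.2.1, hne.2.2.2⟩
    · rintro rfl
      exact hne.1 rfl
    · rintro rfl
      exact hne.2.1 rfl
  rcases h.const_or_corner _ Finset.univ Finset.univ rfl ⟨⟨0, hn⟩, Finset.mem_univ _⟩
    ⟨⟨0, hm⟩, Finset.mem_univ _⟩ with ⟨i, -, v, hv⟩ | ⟨j, -, v, hv⟩ |
    ⟨x, y, z, hxy, hxz, hyz, hr, hc⟩
  · exact Or.inl (Or.inl ⟨i, fun j j' =>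
      (hv j (Finset.mem_univ j)).trans (hv j' (Finset.mem_univ j')).symm⟩)
  · exact Or.inl (Or.inr ⟨j, fun i i' =>
      (hv i (Finset.mem_univ i)).trans (hv i' (Finset.mem_univ i')).symm⟩)
  right
  obtain ⟨⟨i₁, -, hr₁⟩, ⟨i₂, -, hr₂⟩, ⟨i₃, -, hr₃⟩⟩ := hr
  obtain ⟨⟨j₁, -, hc₁⟩, ⟨j₂, -, hc₂⟩, ⟨j₃, -, hc₃⟩⟩ := hc
  simp only [Finset.mem_univ, forall_const] at hr₁ hr₂ hr₃ hc₁ hc₂ hc₃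
  have e₁₂ : a i₁ j₂ = x := by grind
  have e₁₃ : a i₁ j₃ = z := by grind
  have e₂₁ : a i₂ j₁ = x := by grind
  have e₂₃ : a i₂ j₃ = y := by grind
  have e₃₁ : a i₃ j₁ = z := by grind
  have e₃₂ : a i₃ j₂ = y := by grind
  have d₁ := hr₁ j₁
  have d₂ := hr₂ j₂
  have d₃ := hr₃ j₃
  have d₁₂ := h i₁ i₂ j₁ j₂
  have d₁₃ := h i₁ i₃ j₁ j₃
  have d₂₃ := h i₂ i₃ j₂ j₃
  have hdiag : (a i₁ j₁ = x ∧ a i₂ j₂ = y ∧ a i₃ j₃ = z) ∨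
      (a i₁ j₁ = z ∧ a i₂ j₂ = x ∧ a i₃ j₃ = y) := by grind
  rcases hdiag with ⟨e₁₁, e₂₂, e₃₃⟩ | ⟨e₁₁, e₂₂, e₃₃⟩
  · refine ⟨i₁, i₂, i₃, j₁, j₂, j₃, x, y, z, ?_, ?_, ?_, ?_, ?_, ?_, hxy, hxz, hyz,
      e₁₁, e₁₂, e₁₃, e₂₁, e₂₂, e₂₃, e₃₁, e₃₂, e₃₃,
      fun j _ _ _ => ⟨hr₁ j, hr₂ j, hr₃ j⟩, fun i _ _ _ => ⟨hc₁ i, hc₂ i, hc₃ i⟩⟩ <;> grind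
  · refine ⟨i₁, i₃, i₂, j₁, j₃, j₂, z, y, x, ?_, ?_, ?_, ?_, ?_, ?_, hyz.symm, hxz.symm, hxy.symm,
      e₁₁, e₁₃, e₁₂, e₃₁, e₃₃, e₃₂, e₂₁, e₂₃, e₂₂,
      fun j _ _ _ => ⟨(hr₁ j).symm, (hr₃ j).symm, (hr₂ j).symm⟩,
      fun i _ _ _ => ⟨(hc₁ i).symm, (hc₃ i).symm, (hc₂ i).symm⟩⟩ <;> grind
end

section
/- Let g be a finite two-player game with strategy sets S_1 and S_2 each of cardinality at least 2, outcome set O, outcome function v, and preferences <_1, <_2 that are strict linear (total) orders on O. Suppose the maximising improvement is weakly terminating in g: from every profile there is a finite path of maximising-improvement steps ending at a Nash equilibrium. Then there exist a player i ∈ {1, 2} and a strategy s_i ∈ S_i such that the maximising improvement is also weakly terminating in the subgame g' obtained by restricting player i's strategy set to S_i \ {s_i} (the other strategy set, the outcome function and the preferences being restricted accordingly). -/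
/-- Maximising improvement is weakly terminating: from every profile some finite
sequence of maximising-improvement steps reaches a Nash equilibrium. -/
def WeaklyTerm {Sa Sb O : Type*} (v : Sa × Sb → O) (pa pb : O → O → Prop) : Prop :=
  ∀ s : Sa × Sb, ∃ (nn : ℕ) (f : ℕ → Sa × Sb) (pl : ℕ → Bool),
    f 0 = s ∧ (∀ k < nn, MaxImpr v pa pb (pl k) (f k) (f (k + 1))) ∧ IsNE v pa pb (f nn)

section MaximisingImprovement

variable {A B O : Type*} {v : A × B → O} {r₁ r₂ : O → O → Prop}

/-- `a` is a best response of the first player to `b`. -/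
def IsBestFst (v : A × B → O) (r₁ : O → O → Prop) (a : A) (b : B) : Prop :=
  ∀ t, ¬ r₁ (v (a, b)) (v (t, b))

/-- `b` is a best response of the second player to `a`. -/
def IsBestSnd (v : A × B → O) (r₂ : O → O → Prop) (a : A) (b : B) : Prop :=
  ∀ t, ¬ r₂ (v (a, b)) (v (a, t))

/-- A profile whose first component is `a` can be brought to a Nash equilibrium by at most `n`
rounds of best responses, each made of a response of the second player followed by one of the
first player. -/
def NashWithin (v : A × B → O) (r₁ r₂ : O → O → Prop) : ℕ → A → Prop
  | 0, a => ∃ b, IsBestSnd v r₂ a b ∧ IsBestFst v r₁ a b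
  | n + 1, a => ∃ b, IsBestSnd v r₂ a b ∧ ∃ a', IsBestFst v r₁ a' b ∧ NashWithin v r₁ r₂ n a'

/-- Some finite sequence of maximising improvements leads from `s` to a Nash equilibrium. -/
def ReachesNash (v : A × B → O) (r₁ r₂ : O → O → Prop) (s : A × B) : Prop :=
  ∃ t, Relation.ReflTransGen (fun s s' => ∃ p, MaxImpr v r₁ r₂ p s s') s t ∧ IsNE v r₁ r₂ t

theorem isNE_iff {a : A} {b : B} :
    IsNE v r₁ r₂ (a, b) ↔ IsBestFst v r₁ a b ∧ IsBestSnd v r₂ a b := by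
  constructor
  · intro h
    exact ⟨fun t ht => h true (t, b) ⟨rfl, ht⟩, fun t ht => h false (a, t) ⟨rfl, ht⟩⟩
  · rintro ⟨h₁, h₂⟩ (_ | _) ⟨a', b'⟩ ⟨hc, hp⟩
    · obtain rfl : a = a' := hc
      exact h₂ b' hp
    · obtain rfl : b = b' := hc
      exact h₁ a' hp

theorem weaklyTerm_iff_forall_reachesNash :
    WeaklyTerm v r₁ r₂ ↔ ∀ s, ReachesNash v r₁ r₂ s := by
  refine forall_congr' fun s => ⟨?_, ?_⟩
  · rintro ⟨n, f, pl, rfl, hstep, hne⟩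
    refine ⟨f n, ?_, hne⟩
    have key : ∀ k ≤ n,
        Relation.ReflTransGen (fun s s' => ∃ p, MaxImpr v r₁ r₂ p s s') (f 0) (f k) := by
      intro k
      induction k with
      | zero => exact fun _ => .refl
      | succ k ih => exact fun hk => (ih (by omega)).tail ⟨pl k, hstep k hk⟩
    exact key n le_rfl
  · rintro ⟨t, hst, hne⟩
    induction hst using Relation.ReflTransGen.head_induction_on with
    | refl => exact ⟨0, fun _ => t, fun _ => true, rfl, by simp, hne⟩
    | @head a c hac _ ih =>
      obtain ⟨n, f, pl, rfl, hstep, hne⟩ := ih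
      obtain ⟨p, hp⟩ := hac
      refine ⟨n + 1, fun k => k.casesOn a f, fun k => k.casesOn p pl, rfl, ?_, hne⟩
      rintro (_ | k) hk
      · exact hp
      · exact hstep k (by omega)

theorem ReachesNash.head {p : Bool} {s s' : A × B} (h : MaxImpr v r₁ r₂ p s s')
    (h' : ReachesNash v r₁ r₂ s') : ReachesNash v r₁ r₂ s :=
  h'.imp fun _ ht => ⟨.head ⟨p, h⟩ ht.1, ht.2⟩

theorem reachesNash_of_isNE {s : A × B} (h : IsNE v r₁ r₂ s) : ReachesNash v r₁ r₂ s :=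
  ⟨s, .refl, h⟩

theorem exists_forall_not_lt {α : Type*} [Finite α] [Nonempty α] (f : α → O)
    (r : O → O → Prop) [IsStrictTotalOrder O r] : ∃ a, ∀ t, ¬ r (f a) (f t) := by
  let q : α → α → Prop := fun x y => r (f y) (f x)
  have : IsTrans α q := ⟨fun _ _ _ h h' => _root_.trans_of r h' h⟩
  have : Std.Irrefl q := ⟨fun x => irrefl_of r (f x)⟩
  obtain ⟨a, -, ha⟩ :=
    (Finite.wellFounded_of_trans_of_irrefl q).has_min Set.univ Set.univ_nonempty
  exact ⟨a, fun t => ha t trivial⟩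

theorem rel_of_rel_of_not_rel (r : O → O → Prop) [IsStrictTotalOrder O r] {x y z : O}
    (h : r x y) (h' : ¬ r z y) : r x z := by
  rcases trichotomous_of r y z with hyz | rfl | hzy
  · exact _root_.trans_of r h hyz
  · exact h
  · exact absurd hzy h'

theorem maxImpr_fst [IsStrictTotalOrder O r₁] {a a' : A} {b : B} (h : ¬ IsBestFst v r₁ a b)
    (h' : IsBestFst v r₁ a' b) : MaxImpr v r₁ r₂ true (a, b) (a', b) := by
  obtain ⟨t, ht⟩ := not_forall_not.mp h
  exact ⟨⟨rfl, rel_of_rel_of_not_rel r₁ ht (h' t)⟩, h'⟩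

theorem maxImpr_snd [IsStrictTotalOrder O r₂] {a : A} {b b' : B} (h : ¬ IsBestSnd v r₂ a b)
    (h' : IsBestSnd v r₂ a b') : MaxImpr v r₁ r₂ false (a, b) (a, b') := by
  obtain ⟨t, ht⟩ := not_forall_not.mp h
  exact ⟨⟨rfl, rel_of_rel_of_not_rel r₂ ht (h' t)⟩, h'⟩

theorem NashWithin.reachesNash [IsStrictTotalOrder O r₁] [IsStrictTotalOrder O r₂] {n : ℕ}
    {a : A} (h : NashWithin v r₁ r₂ n a) {b : B} (hab : IsBestFst v r₁ a b) :
    ReachesNash v r₁ r₂ (a, b) := by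
  induction n generalizing a b with
  | zero =>
    obtain ⟨b', hb', hab'⟩ := h
    by_cases hb : IsBestSnd v r₂ a b
    · exact reachesNash_of_isNE (isNE_iff.mpr ⟨hab, hb⟩)
    · exact .head (maxImpr_snd hb hb') (reachesNash_of_isNE (isNE_iff.mpr ⟨hab', hb'⟩))
  | succ n ih =>
    obtain ⟨b', hb', a', ha', hn⟩ := h
    by_cases hb : IsBestSnd v r₂ a b
    · exact reachesNash_of_isNE (isNE_iff.mpr ⟨hab, hb⟩)
    refine .head (maxImpr_snd hb hb') ?_
    by_cases ha : IsBestFst v r₁ a b'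
    · exact reachesNash_of_isNE (isNE_iff.mpr ⟨ha, hb'⟩)
    · exact .head (maxImpr_fst ha ha') (ih hn ha')

theorem ReachesNash.exists_nashWithin {s : A × B} (h : ReachesNash v r₁ r₂ s)
    (hs : IsBestFst v r₁ s.1 s.2 ∨ IsBestSnd v r₂ s.1 s.2) :
    ∃ n, NashWithin v r₁ r₂ n s.1 := by
  obtain ⟨t, hst, hne⟩ := h
  induction hst using Relation.ReflTransGen.head_induction_on with
  | refl => exact ⟨0, t.2, (isNE_iff.mp hne).symm⟩
  | @head s s' hstep _ ih =>
    obtain ⟨a, b⟩ := s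
    obtain ⟨a', b'⟩ := s'
    obtain ⟨_ | _, ⟨hc, hp⟩, hmax⟩ := hstep
    · obtain rfl : a = a' := hc
      exact ih (.inr hmax)
    · obtain rfl : b = b' := hc
      obtain ⟨n, hn⟩ := ih (.inl hmax)
      exact ⟨n + 1, b, hs.resolve_left fun h => h a' hp, a', hmax, hn⟩

theorem weaklyTerm_iff_forall_exists_nashWithin [Finite A] [Nonempty A] [Finite B] [Nonempty B]
    [IsStrictTotalOrder O r₁] [IsStrictTotalOrder O r₂] :
    WeaklyTerm v r₁ r₂ ↔ ∀ a, ∃ n, NashWithin v r₁ r₂ n a := by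
  rw [weaklyTerm_iff_forall_reachesNash]
  constructor
  · intro h a
    obtain ⟨b, hb⟩ := exists_forall_not_lt (fun b => v (a, b)) r₂
    exact (h (a, b)).exists_nashWithin (.inr hb)
  · rintro h ⟨a, b⟩
    by_cases ha : IsBestFst v r₁ a b
    · exact (h a).choose_spec.reachesNash ha
    · obtain ⟨a', ha'⟩ := exists_forall_not_lt (fun a => v (a, b)) r₁
      exact .head (maxImpr_fst ha ha') ((h a').choose_spec.reachesNash ha')

/-- Short best-response paths avoid a strategy that is far from every Nash equilibrium. -/
theorem NashWithin.restrict {x : A} {N n : ℕ} (hx : ∀ k < N, ¬ NashWithin v r₁ r₂ k x)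
    (hn : n ≤ N) (a : {t : A // t ≠ x}) (h : NashWithin v r₁ r₂ n a.1) :
    NashWithin (fun q : {t : A // t ≠ x} × B => v (q.1.1, q.2)) r₁ r₂ n a := by
  induction n generalizing a with
  | zero => exact h.imp fun b hb => ⟨hb.1, fun t => hb.2 t.1⟩
  | succ n ih =>
    obtain ⟨b, hb, a', ha', h'⟩ := h
    have hne : a' ≠ x := by
      rintro rfl
      exact hx n hn h'
    exact ⟨b, hb, ⟨a', hne⟩, fun t => ha' t.1, ih (by omega) ⟨a', hne⟩ h'⟩

end MaximisingImprovement

theorem statement14 {S1 S2 O : Type*} [Finite S1] [Finite S2]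
    (hcard1 : 1 < Nat.card S1) (hcard2 : 1 < Nat.card S2)
    (v : S1 × S2 → O) (lt1 lt2 : O → O → Prop)
    (hlt1 : IsStrictTotalOrder O lt1) (hlt2 : IsStrictTotalOrder O lt2)
    (hwt : WeaklyTerm v lt1 lt2) :
    (∃ s1 : S1, WeaklyTerm (fun q : {t : S1 // t ≠ s1} × S2 => v (q.1.1, q.2)) lt1 lt2) ∨
    (∃ s2 : S2, WeaklyTerm (fun q : S1 × {t : S2 // t ≠ s2} => v (q.1, q.2.1)) lt1 lt2) := by
  have : Nontrivial S1 := Finite.one_lt_card_iff_nontrivial.mp hcard1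
  have : Nontrivial S2 := Finite.one_lt_card_iff_nontrivial.mp hcard2
  rw [weaklyTerm_iff_forall_exists_nashWithin] at hwt
  classical
  obtain ⟨x, hx⟩ := Finite.exists_max fun a => Nat.find (hwt a)
  obtain ⟨y, hy⟩ := exists_ne x
  have : Nonempty {t : S1 // t ≠ x} := ⟨⟨y, hy⟩⟩
  refine .inl ⟨x, weaklyTerm_iff_forall_exists_nashWithin.mpr fun a => ⟨Nat.find (hwt a), ?_⟩⟩
  exact NashWithin.restrict (fun _ => Nat.find_min (hwt x)) (hx a) a (Nat.find_spec (hwt a))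
end
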